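/- Fix a sequence (α_k) in {A,B} and an α_k-admissible sequence of index data (i_k). Two α_k-admissible sequences (β_k), (β'_k) in {A,B} are eventually equal if and only if their direct limits coincide: lim_→ F^{β_k}_k = lim_→ F^{β'_k}_k as colored edge-indexed graphs. -/

import Mathlib

open scoped Classical

noncomputable section

namespace Sturm

variable {V α : Type}

/-- `G` is a `d`-regular tree. -/
structure IsRegularTree (G : SimpleGraph V) (d : ℕ) : Prop where
  isTree : G.IsTree
  regular : ∀ v : V, (G.neighborSet v).ncard = d

/-- Color-preserving isomorphism of the `n`-balls centered at `x` and `y`,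
sending center to center. -/
def BallEquiv (G : SimpleGraph V) (φ : V → α) (n : ℕ) (x y : V) : Prop :=
  ∃ f : {z : V // G.dist x z ≤ n} ≃ {z : V // G.dist y z ≤ n},
    (∀ u v : {z : V // G.dist x z ≤ n}, G.Adj u.1 v.1 ↔ G.Adj (f u).1 (f v).1) ∧
    (∀ u : {z : V // G.dist x z ≤ n}, φ (f u).1 = φ u.1) ∧
    ((f ⟨x, by rw [SimpleGraph.dist_self]; exact Nat.zero_le n⟩).1 = y)

/-- The class of the `n`-ball at `x`, viewed as the set of all centers of equivalent balls. -/
def ballClass (G : SimpleGraph V) (φ : V → α) (n : ℕ) (x : V) : Set V :=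
  {y | BallEquiv G φ n x y}

/-- The set `B_n(φ)` of classes of `n`-balls occurring in `(T, φ)`. -/
def ballClasses (G : SimpleGraph V) (φ : V → α) (n : ℕ) : Set (Set V) :=
  {C | ∃ x, C = ballClass G φ n x}

/-- A coloring is Sturmian if its factor complexity is `n + 2`. -/
def IsSturmian (G : SimpleGraph V) (φ : V → α) : Prop :=
  ∀ n, (ballClasses G φ n).ncard = n + 2

/-- `x` is the center of a special `n`-ball. -/
def IsSpecialVert (G : SimpleGraph V) (φ : V → α) (n : ℕ) (x : V) : Prop :=
  ∃ y, BallEquiv G φ n x y ∧ ¬ BallEquiv G φ (n + 1) x y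

/-- `S` is a special class of `n`-balls: the restriction of two distinct classes of
`(n+1)`-balls. -/
def IsSpecialClass (G : SimpleGraph V) (φ : V → α) (n : ℕ) (S : Set V) : Prop :=
  ∃ x, S = ballClass G φ n x ∧ IsSpecialVert G φ n x

/-- The class `D` is always adjacent to the class `E`. -/
def AlwaysAdjTo (G : SimpleGraph V) (D E : Set V) : Prop :=
  ∀ x ∈ D, ∃ y, G.Adj x y ∧ y ∈ E

/-- The classes `D` and `E` are (always) adjacent. -/
def AlwaysAdj (G : SimpleGraph V) (D E : Set V) : Prop :=
  AlwaysAdjTo G D E ∧ AlwaysAdjTo G E D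

/-- The classes `D` and `E` can be adjacent. -/
def CanAdj (G : SimpleGraph V) (D E : Set V) : Prop :=
  ∃ x ∈ D, ∃ y ∈ E, G.Adj x y

/-- The number of neighbors of `x` lying in (i.e. being centers of balls of class) `E`. -/
def nbrCount (G : SimpleGraph V) (x : V) (E : Set V) : ℕ :=
  (G.neighborSet x ∩ E).ncard

/-- The data of the labels `S_n, C_n, A_n, B_n` for a Sturmian coloring, normalized as in
the paper: `S_0 = A_0 = [a]`, `B_0 = [b]`, `A_{n+1}` (resp. `B_{n+1}`) is always adjacent
to `A_n` (resp. `B_n`), and `A_{n+1}, B_{n+1}` are the two distinct extensions of `S_n`. -/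
structure Labeling (G : SimpleGraph V) (φ : V → α) (a b : α) where
  S : ℕ → Set V
  C : ℕ → Set V
  A : ℕ → Set V
  B : ℕ → Set V
  S_special : ∀ n, IsSpecialClass G φ n (S n)
  C_central : ∀ n, ∃ x, IsSpecialVert G φ (n + 1) x ∧ S (n + 1) = ballClass G φ (n + 1) x ∧
      C n = ballClass G φ n x
  A0_eq_S0 : A 0 = S 0
  A0_col : ∃ x, φ x = a ∧ A 0 = ballClass G φ 0 x
  B0_col : ∃ x, φ x = b ∧ B 0 = ballClass G φ 0 x
  A_ext : ∀ n, ∃ x, IsSpecialVert G φ n x ∧ S n = ballClass G φ n x ∧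
      A (n + 1) = ballClass G φ (n + 1) x
  B_ext : ∀ n, ∃ x, IsSpecialVert G φ n x ∧ S n = ballClass G φ n x ∧
      B (n + 1) = ballClass G φ (n + 1) x
  AB_ne : ∀ n, A (n + 1) ≠ B (n + 1)
  A_adj : ∀ n, AlwaysAdjTo G (A (n + 1)) (A n)
  B_adj : ∀ n, AlwaysAdjTo G (B (n + 1)) (B n)

/-- A cycle (of length `≥ 3`, with pairwise distinct vertices) in the graph `G_n` of
classes of `n`-balls, where classes are joined when they can be adjacent. -/
def IsCycleIn (G : SimpleGraph V) (φ : V → α) (n k : ℕ) (c : ℕ → Set V) : Prop :=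
  3 ≤ k ∧ (∀ i < k, c i ∈ ballClasses G φ n) ∧
    (∀ i < k, CanAdj G (c i) (c ((i + 1) % k))) ∧
    (∀ i < k, ∀ j < k, c i = c j → i = j)

/-- The graph `G_n` contains a cycle. -/
def HasCycle (G : SimpleGraph V) (φ : V → α) (n : ℕ) : Prop :=
  ∃ k c, IsCycleIn G φ n k c

/-! ## Edge-indexed colored graphs -/

/-- An edge-indexed graph, with vertices colored by `α` and labeled by classes
(sets of vertices of the underlying tree `V`). Index `0` means "no edge". -/
structure EIG (V α : Type) where
  Vert : Type
  idx : Vert → Vert → ℕ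
  col : Vert → α
  lab : Vert → Set V

/-- Isomorphism of colored edge-indexed graphs. -/
structure EIGIso (X Y : EIG V α) where
  e : X.Vert ≃ Y.Vert
  idx_eq : ∀ u v, Y.idx (e u) (e v) = X.idx u v
  col_eq : ∀ u, Y.col (e u) = X.col u

/-- The index `i_A(D, E)` (resp. `i_B`, `i`) at the level of classes: the number of
neighbors, in class `E`, of a representative center of `D`; when `D` is the special
class `Sp`, the representative is taken with extension of class `Ext`. -/
def classIdx (G : SimpleGraph V) (Sp Ext : Set V) (D E : Set V) : ℕ :=
  if D = Sp then (if h : Ext.Nonempty then nbrCount G h.some E else 0)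
  else (if h : D.Nonempty then nbrCount G h.some E else 0)

/-- The classes of `n`-balls joined to `Sp` by a path of edges of positive `J`-index. -/
def reachSet (G : SimpleGraph V) (φ : V → α) (n : ℕ) (Sp : Set V)
    (J : Set V → Set V → ℕ) : Set (Set V) :=
  {D | ∃ k, ∃ c : ℕ → Set V, c 0 = Sp ∧ c k = D ∧ (∀ i ≤ k, c i ∈ ballClasses G φ n) ∧
    ∀ i < k, 0 < J (c i) (c (i + 1)) ∨ 0 < J (c (i + 1)) (c i)}

/-- Color of a class: the color of (the center of) any of its representatives. -/
def colOf [Nonempty V] (φ : V → α) (D : Set V) : α :=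
  if h : D.Nonempty then φ h.some else φ (Classical.arbitrary V)

/-- The edge-indexed graph `G^A_n` (when `Ext = A_{n+1}`) resp. `G^B_n`. -/
def sideEIG [Nonempty V] (G : SimpleGraph V) (φ : V → α) (n : ℕ) (Sp Ext : Set V) :
    EIG V α where
  Vert := {D : Set V // D ∈ reachSet G φ n Sp (classIdx G Sp Ext)}
  idx := fun D E => classIdx G Sp Ext D.1 E.1
  col := fun D => colOf φ D.1
  lab := fun D => D.1

variable {G : SimpleGraph V} {φ : V → α} {a b : α}

/-- The edge-indexed graph `G^A_n`. -/
def GAeig [Nonempty V] (L : Labeling G φ a b) (n : ℕ) : EIG V α :=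
  sideEIG G φ n (L.S n) (L.A (n + 1))

/-- The edge-indexed graph `G^B_n`. -/
def GBeig [Nonempty V] (L : Labeling G φ a b) (n : ℕ) : EIG V α :=
  sideEIG G φ n (L.S n) (L.B (n + 1))

/-- Vertex set of `G^A_n`. -/
def VGAset (L : Labeling G φ a b) (n : ℕ) : Set (Set V) :=
  reachSet G φ n (L.S n) (classIdx G (L.S n) (L.A (n + 1)))

/-- Vertex set of `G^B_n`. -/
def VGBset (L : Labeling G φ a b) (n : ℕ) : Set (Set V) :=
  reachSet G φ n (L.S n) (classIdx G (L.S n) (L.B (n + 1)))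

/-- `G^A_n` or `G^B_n`, selected by a letter (`true = A`, `false = B`). -/
def GsideEIG [Nonempty V] (L : Labeling G φ a b) (n : ℕ) : Bool → EIG V α
  | true => GAeig L n
  | false => GBeig L n

/-- Vertex set of `G^A_n` or `G^B_n`, selected by a letter. -/
def VGside (L : Labeling G φ a b) (n : ℕ) : Bool → Set (Set V)
  | true => VGAset L n
  | false => VGBset L n

/-- A single vertex with a loop of index `d` (the graph `G^A_{-1} = G^B_{-1} = F^._{-1}`). -/
def baseEIG (V : Type) (x : α) (d : ℕ) : EIG V α where
  Vert := PUnit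
  idx := fun _ _ => d
  col := fun _ => x
  lab := fun _ => Set.univ

/-- `GAx L d (n+1) = G^A_n`, and `GAx L d 0 = G^A_{-1}`. -/
def GAx [Nonempty V] (L : Labeling G φ a b) (d : ℕ) : ℕ → EIG V α
  | 0 => baseEIG V a d
  | n + 1 => GAeig L n

/-- `GBx L d (n+1) = G^B_n`, and `GBx L d 0 = G^B_{-1}`. -/
def GBx [Nonempty V] (L : Labeling G φ a b) (d : ℕ) : ℕ → EIG V α
  | 0 => baseEIG V b d
  | n + 1 => GBeig L n

/-- `Cx L (n+1) = C_n`, and `Cx L 0 = C_{-1}` (the class of the empty ball). -/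
def Cx (L : Labeling G φ a b) : ℕ → Set V
  | 0 => Set.univ
  | n + 1 => L.C n

/-! ## Concatenations -/

/-- The `(i)`-concatenation of two edge-indexed graphs at the end vertices `v, v'`
(which are identified). -/
def concatI (X Y : EIG V α) (v : X.Vert) (v' : Y.Vert) (i : ℕ) : EIG V α where
  Vert := X.Vert ⊕ {w : Y.Vert // w ≠ v'}
  idx := fun p q =>
    match p, q with
    | Sum.inl u, Sum.inl w =>
        if u = v ∧ w ≠ v then (if X.idx u w = 0 then 0 else i) else X.idx u w
    | Sum.inl u, Sum.inr w => if u = v then Y.idx v' w.1 - i else 0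
    | Sum.inr w, Sum.inl u => if u = v then Y.idx w.1 v' else 0
    | Sum.inr w, Sum.inr w2 => Y.idx w.1 w2.1
  col := Sum.elim X.col (fun w => Y.col w.1)
  lab := Sum.elim X.lab (fun w => Y.lab w.1)

/-- The `(i,j)`-concatenation of two edge-indexed graphs at the end vertices `v, v'`
(which stay distinct, joined by a new edge of indices `i`, `j`). -/
def concatIJ (X Y : EIG V α) (v : X.Vert) (v' : Y.Vert) (i j : ℕ) : EIG V α where
  Vert := X.Vert ⊕ Y.Vert
  idx := fun p q =>
    match p, q with
    | Sum.inl u, Sum.inl w => if u = v ∧ w = v then X.idx v v - i else X.idx u w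
    | Sum.inl u, Sum.inr w => if u = v ∧ w = v' then i else 0
    | Sum.inr w, Sum.inl u => if w = v' ∧ u = v then j else 0
    | Sum.inr u, Sum.inr w => if u = v' ∧ w = v' then Y.idx v' v' - j else Y.idx u w
  col := Sum.elim X.col Y.col
  lab := Sum.elim X.lab Y.lab

/-- `Z` is a concatenation ((i)- or (i,j)-) of `X` and `Y` at `(vX, vY)`. -/
def IsConcatOfAt (Z X Y : EIG V α) (vX : X.Vert) (vY : Y.Vert) : Prop :=
  (∃ i, 1 ≤ i ∧ Nonempty (EIGIso Z (concatI X Y vX vY i))) ∨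
  (∃ i j, 1 ≤ i ∧ 1 ≤ j ∧ Nonempty (EIGIso Z (concatIJ X Y vX vY i j)))

/-! ## Paths, distance, degree in edge-indexed graphs -/

/-- Adjacency (by an edge of positive index, in one of the two orientations). -/
def EIGAdj (X : EIG V α) (u w : X.Vert) : Prop :=
  u ≠ w ∧ (0 < X.idx u w ∨ 0 < X.idx w u)

/-- There is a path of length `L` from `u` to `w`. -/
def EIGReach (X : EIG V α) (u w : X.Vert) (L : ℕ) : Prop :=
  ∃ c : ℕ → X.Vert, c 0 = u ∧ c L = w ∧ ∀ i < L, EIGAdj X (c i) (c (i + 1))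

/-- Graph distance in an edge-indexed graph. -/
def EIGDist (X : EIG V α) (u w : X.Vert) : ℕ :=
  sInf {L | EIGReach X u w L}

/-- `u` has degree one: there is exactly one vertex adjacent to it. -/
def EIGEndVert (X : EIG V α) (u : X.Vert) : Prop :=
  ∃! w, EIGAdj X u w

/-! ## Coverings, direct limits, quotient graph, bounded type -/

/-- `p` exhibits the graph `H` as the universal cover of the edge-indexed graph `Y`:
above a vertex mapping to `u`, the number of neighbors above `w` is the index `idx u w`. -/
def IsEIGCover {W : Type} (H : SimpleGraph W) (Y : EIG V α) (p : W → Y.Vert) : Prop :=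
  ∀ x : W, ∀ u : Y.Vert, (H.neighborSet x ∩ p ⁻¹' {u}).ncard = Y.idx (p x) u

/-- `Y` is the direct limit of the system `F` of colored edge-indexed graphs along the
inclusions `ι`. -/
def IsDirLimit (F : ℕ → EIG V α) (ι : ∀ k, (F k).Vert → (F (k + 1)).Vert)
    (Y : EIG V α) : Prop :=
  ∃ j : ∀ k, (F k).Vert → Y.Vert,
    (∀ k v, j (k + 1) (ι k v) = j k v) ∧
    (∀ k, Function.Injective (j k)) ∧
    (∀ y, ∃ k v, j k v = y) ∧
    (∀ k v, Y.col (j k v) = (F k).col v) ∧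
    (∀ y z : Y.Vert, ∃ N, ∀ k, N ≤ k → ∀ v w, j k v = y → j k w = z →
      Y.idx y z = (F k).idx v w)

/-- The coloring `φ` is of bounded type: every vertex has finite type set. -/
def BoundedType (G : SimpleGraph V) (φ : V → α) : Prop :=
  ∀ v : V, {m : ℕ | IsSpecialVert G φ m v}.Finite

/-- Two vertices are related if some color-preserving automorphism maps one to the other. -/
def colorOrbitRel (G : SimpleGraph V) (φ : V → α) (x y : V) : Prop :=
  ∃ g : V ≃ V, (∀ u w, G.Adj u w ↔ G.Adj (g u) (g w)) ∧ (∀ u, φ (g u) = φ u) ∧ g x = y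

/-- The quotient graph `X_φ = G\T` as a colored edge-indexed graph. -/
def quotEIG (G : SimpleGraph V) (φ : V → α) : EIG V α where
  Vert := Quot (colorOrbitRel G φ)
  idx := fun u w => (G.neighborSet u.out ∩ {z | Quot.mk (colorOrbitRel G φ) z = w}).ncard
  col := fun u => φ u.out
  lab := fun u => {z | Quot.mk (colorOrbitRel G φ) z = u}

/-! ## The sequences `n_k`, `α_k`, `β_k` -/

/-- At level `n`, one of `A_n, B_n` is `S_n` or `C_n`. -/
def SpecTouch (L : Labeling G φ a b) (n : ℕ) : Prop :=
  L.A n = L.S n ∨ L.A n = L.C n ∨ L.B n = L.S n ∨ L.B n = L.C n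

/-- `nk` is the increasing enumeration of the levels where `SpecTouch` holds. -/
def IsNkSeq (L : Labeling G φ a b) (nk : ℕ → ℕ) : Prop :=
  StrictMono nk ∧ ∀ n, (∃ k, nk k = n) ↔ SpecTouch L n

/-- `αs` is the sequence `α_k`: `α_K = A`, and for `k ≠ K`, `α_k` is the side whose
graph `G^{α_k}_{n_k}` has more vertices. -/
def IsAlphaSeq (L : Labeling G φ a b) (nk : ℕ → ℕ) (K : ℕ∞) (αs : ℕ → Bool) : Prop :=
  ∀ k : ℕ, ((k : ℕ∞) = K → αs k = true) ∧
    ((k : ℕ∞) ≠ K → (αs k = true ↔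
      (VGside L (nk k) false).ncard < (VGside L (nk k) true).ncard))

/-- The sequence `β_k(t)`: `β_{k-1}(t)` is the letter `ᾱ_k` if the class of the
`n_k`-ball at `t` is a vertex of `G^{ᾱ_k}_{n_k}`, and `α_k` otherwise. -/
def betaOf (L : Labeling G φ a b) (nk : ℕ → ℕ) (αs : ℕ → Bool) (t : V) (k : ℕ) : Bool :=
  if ballClass G φ (nk (k + 1)) t ∈ VGside L (nk (k + 1)) (!(αs (k + 1))) then
    !(αs (k + 1))
  else αs (k + 1)

end Sturm

namespace Sturm

variable {V α : Type}

/-! ## The graphs `F^A_k, F^B_k` built from admissible sequences -/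

/-- Index data for one step of the construction: a single index, a pair, or a triple. -/
inductive IdxData : Type
  | one : ℕ → IdxData
  | two : ℕ → ℕ → IdxData
  | three : ℕ → ℕ → ℕ → IdxData

/-- The `i`-component of an index datum. -/
def IdxData.iOf : IdxData → ℕ
  | .one i => i
  | .two i _ => i
  | .three i _ _ => i

/-- The `j`-component of an index datum. -/
def IdxData.jOf : IdxData → ℕ
  | .one i => i
  | .two _ j => j
  | .three _ _ j => j

/-- `k < K` where `K = min {k | α_k = A}` (with `true = A`). -/
def LtK (αs : ℕ → Bool) (k : ℕ) : Prop := ∀ j ≤ k, αs j = false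

/-- `k = K`. -/
def IsK (αs : ℕ → Bool) (k : ℕ) : Prop := αs k = true ∧ ∀ j < k, αs j = false

/-- `k > K`. -/
def GtK (αs : ℕ → Bool) (k : ℕ) : Prop := ∃ j < k, αs j = true

/-- Base case of the recursion for `(𝔦^A_k, 𝔦^B_k, 𝔦^C_k)` at `k = K`. -/
def frakBase (idat : ℕ → IdxData) (k : ℕ) : ℕ × ℕ × ℕ :=
  match idat k with
  | .two i _ => (i, if k = 0 then 0 else (idat (k - 1)).iOf, (idat 0).jOf)
  | .three i i' _ => (i, i', (idat 0).jOf)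
  | .one i => (i, if k = 0 then 0 else (idat (k - 1)).iOf, (idat 0).jOf)

/-- The sequence `(𝔦^A_k, 𝔦^B_k, 𝔦^C_k)` of indices at the end vertices. -/
def frak (αs : ℕ → Bool) (idat : ℕ → IdxData) : ℕ → ℕ × ℕ × ℕ :=
  fun k =>
    Nat.rec (if αs 0 = true then frakBase idat 0 else (0, 0, 0))
      (fun k p =>
        if IsK αs (k + 1) then frakBase idat (k + 1)
        else if GtK αs (k + 1) then
          (if αs (k + 1) = true then (p.1, p.2.2, p.2.1) else (p.2.2, p.2.1, p.1))
        else (0, 0, 0)) k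

/-- The quantity `𝔦^C_k`. -/
def frakC (αs : ℕ → Bool) (idat : ℕ → IdxData) (k : ℕ) : ℕ := (frak αs idat k).2.2

/-- The sequence of index data `(i_k)` is `α_k`-admissible (Definition 4.1 of the paper). -/
def AdmissibleIdx (d : ℕ) (αs : ℕ → Bool) (idat : ℕ → IdxData) : Prop :=
  ∀ k : ℕ,
    (LtK αs k →
      ∃ i j, idat k = .two i j ∧ 1 ≤ i ∧ i < d ∧ 1 ≤ j ∧
        j ≤ d - (if k = 0 then 0 else (idat (k - 1)).iOf)) ∧
    (IsK αs k →
      ((∃ i i' j, idat k = .three i i' j ∧ 1 ≤ i ∧ i < i' ∧ i' ≤ d ∧ 1 ≤ j ∧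
          j ≤ d - (if k = 0 then 0 else (idat (k - 1)).iOf)) ∨
       (k ≠ 0 ∧ ∃ i j, idat k = .two i j ∧ 1 ≤ i ∧ i ≤ d ∧ 1 ≤ j ∧
          j ≤ d - (idat (k - 1)).iOf))) ∧
    (GtK αs k →
      ((∃ i, idat k = .one i ∧ 1 ≤ i ∧ i < frakC αs idat (k - 1)) ∨
       (∃ i j, idat k = .two i j ∧ 1 ≤ i ∧ i ≤ d - frakC αs idat (k - 1) ∧ 1 ≤ j ∧
          j ≤ d - frakC αs idat (k - 1))))

/-- An edge-indexed graph with two distinguished end vertices: the "common" end vertex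
`c` and the other end vertex `o`. -/
structure PtdEIG (V α : Type) where
  gr : EIG V α
  c : gr.Vert
  o : gr.Vert

/-- The pair `(F^A_k, F^B_k)` (with distinguished end vertices). -/
structure Sys (V α : Type) where
  FA : PtdEIG V α
  FB : PtdEIG V α

/-- Selecting the `A`- or `B`-side of a system. -/
def Fside (S : Sys V α) : Bool → PtdEIG V α
  | true => S.FA
  | false => S.FB

/-- The result of one step of the recursive construction, together with the natural
inclusions of the previous graphs into the new ones. -/
structure StepRes (S : Sys V α) where
  next : Sys V α
  embA : S.FA.gr.Vert → next.FA.gr.Vert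
  embB : S.FB.gr.Vert → next.FB.gr.Vert
  crossAB : S.FA.gr.Vert → next.FB.gr.Vert
  crossBA : S.FB.gr.Vert → next.FA.gr.Vert

/-- A trivial (junk) step. -/
def trivialStep (S : Sys V α) : StepRes S :=
  { next := S, embA := id, embB := id,
    crossAB := fun _ => S.FB.c, crossBA := fun _ => S.FA.c }

/-- One step of the recursive construction of `(F^A_k, F^B_k)` (Definition 4.2). -/
def Fstep (αs : ℕ → Bool) (idat : ℕ → IdxData) (k : ℕ) (S : Sys V α) : StepRes S :=
  if LtK αs k then
    match idat k with
    | .two i j =>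
      { next := { FA := S.FA,
                  FB := ⟨concatIJ S.FA.gr S.FB.gr S.FA.c S.FB.c i j,
                         Sum.inl S.FA.c, Sum.inr S.FB.o⟩ },
        embA := id, embB := Sum.inr, crossAB := Sum.inl, crossBA := fun _ => S.FA.c }
    | _ => trivialStep S
  else if IsK αs k then
    match idat k with
    | .three i i' j =>
      { next := { FA := ⟨concatIJ S.FA.gr S.FB.gr S.FA.c S.FB.c i j,
                         Sum.inr S.FB.o, Sum.inl S.FA.o⟩,
                  FB := ⟨concatIJ S.FA.gr S.FB.gr S.FA.c S.FB.c i' j,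
                         Sum.inr S.FB.o, Sum.inl S.FA.o⟩ },
        embA := Sum.inl, embB := Sum.inr, crossAB := Sum.inl, crossBA := Sum.inr }
    | .two i j =>
      { next := { FA := ⟨concatIJ S.FA.gr S.FB.gr S.FA.c S.FB.c i j,
                         Sum.inr S.FB.o, Sum.inl S.FA.o⟩,
                  FB := ⟨S.FB.gr, S.FB.o, S.FB.c⟩ },
        embA := Sum.inl, embB := id, crossAB := fun _ => S.FB.o, crossBA := Sum.inr }
    | _ => trivialStep S
  else
    if αs k = true then
      match idat k with
      | .one i =>
        { next := { FA := ⟨concatI S.FA.gr S.FB.gr S.FA.c S.FB.c i,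
                           (if h : S.FB.o ≠ S.FB.c then Sum.inr ⟨S.FB.o, h⟩
                            else Sum.inl S.FA.c),
                           Sum.inl S.FA.o⟩,
                    FB := ⟨S.FB.gr, S.FB.o, S.FB.c⟩ },
          embA := Sum.inl, embB := id, crossAB := fun _ => S.FB.o,
          crossBA := fun w => if h : w ≠ S.FB.c then Sum.inr ⟨w, h⟩ else Sum.inl S.FA.c }
      | .two i j =>
        { next := { FA := ⟨concatIJ S.FA.gr S.FB.gr S.FA.c S.FB.c i j,
                           Sum.inr S.FB.o, Sum.inl S.FA.o⟩,
                    FB := ⟨S.FB.gr, S.FB.o, S.FB.c⟩ },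
          embA := Sum.inl, embB := id, crossAB := fun _ => S.FB.o, crossBA := Sum.inr }
      | _ => trivialStep S
    else
      match idat k with
      | .one i =>
        { next := { FA := ⟨S.FA.gr, S.FA.o, S.FA.c⟩,
                    FB := ⟨concatI S.FA.gr S.FB.gr S.FA.c S.FB.c i,
                           Sum.inl S.FA.o,
                           (if h : S.FB.o ≠ S.FB.c then Sum.inr ⟨S.FB.o, h⟩
                            else Sum.inl S.FA.c)⟩ },
          embA := id,
          embB := fun w => if h : w ≠ S.FB.c then Sum.inr ⟨w, h⟩ else Sum.inl S.FA.c,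
          crossAB := Sum.inl, crossBA := fun _ => S.FA.o }
      | .two i j =>
        { next := { FA := ⟨S.FA.gr, S.FA.o, S.FA.c⟩,
                    FB := ⟨concatIJ S.FA.gr S.FB.gr S.FA.c S.FB.c i j,
                           Sum.inl S.FA.o, Sum.inr S.FB.o⟩ },
          embA := id, embB := Sum.inr, crossAB := Sum.inl, crossBA := fun _ => S.FA.o }
      | _ => trivialStep S

/-- The base system `(F^A_{-1}, F^B_{-1})`. -/
def baseSys (V : Type) (a b : α) (d : ℕ) : Sys V α :=
  ⟨⟨baseEIG V a d, PUnit.unit, PUnit.unit⟩, ⟨baseEIG V b d, PUnit.unit, PUnit.unit⟩⟩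

/-- The system `(F^A_k, F^B_k)` (Definition 4.2 of the paper). -/
def Fsys (V α : Type) (a b : α) (d : ℕ) (αs : ℕ → Bool) (idat : ℕ → IdxData) :
    ℕ → Sys V α :=
  fun k =>
    Nat.rec ((Fstep αs idat 0 (baseSys V a b d)).next)
      (fun k S => (Fstep αs idat (k + 1) S).next) k

/-- The inclusion of the `x`-side of `S` into the `y`-side of the next system. -/
def StepRes.sel {S : Sys V α} (st : StepRes S) : ∀ x y : Bool,
    (Fside S x).gr.Vert → (Fside st.next y).gr.Vert
  | true, true => st.embA
  | true, false => st.crossAB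
  | false, true => st.crossBA
  | false, false => st.embB

/-- `β` is `α`-admissible: `β_k = α_k` or `β_{k-1}`. -/
def AdmissibleBeta (αs βs : ℕ → Bool) : Prop :=
  ∀ k, βs (k + 1) = αs (k + 1) ∨ βs (k + 1) = βs k

/-- The graph `F^{β_k}_k`. -/
def Fbeta (V α : Type) (a b : α) (d : ℕ) (αs : ℕ → Bool) (idat : ℕ → IdxData)
    (βs : ℕ → Bool) (k : ℕ) : EIG V α :=
  (Fside (Fsys V α a b d αs idat k) (βs k)).gr

/-- The natural inclusion `F^{β_k}_k ↪ F^{β_{k+1}}_{k+1}`. -/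
def betaEmb (V α : Type) (a b : α) (d : ℕ) (αs : ℕ → Bool) (idat : ℕ → IdxData)
    (βs : ℕ → Bool) (k : ℕ) :
    (Fbeta V α a b d αs idat βs k).Vert → (Fbeta V α a b d αs idat βs (k + 1)).Vert :=
  (Fstep αs idat (k + 1) (Fsys V α a b d αs idat k)).sel (βs k) (βs (k + 1))

end Sturm

namespace Sturm

/-! ## Direct limits of edge-indexed graphs -/

/-- A sequence of injections has a colimit, into which every term embeds. -/
theorem exists_colimit (T : ℕ → Type) (ι : ∀ k, T k → T (k + 1))
    (inj : ∀ k, Function.Injective (ι k)) :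
    ∃ (Y : Type) (j : ∀ k, T k → Y), (∀ k v, j (k + 1) (ι k v) = j k v) ∧
      (∀ k, Function.Injective (j k)) ∧ ∀ y, ∃ k v, j k v = y := by
  let f : ∀ i l : ℕ, i ≤ l → T i → T l := fun i l h => Nat.leRecOn h (fun {k} => ι k)
  have hf : ∀ i l h, Function.Injective (f i l h) := fun i l h =>
    Nat.leRecOn_injective h _ (fun k => inj k)
  have hself : ∀ i (x : T i), f i i le_rfl x = x := fun i x => Nat.leRecOn_self x
  let s : Setoid (Σ i, T i) :=
    { r := fun x y => ∃ m, ∃ (hx : x.1 ≤ m) (hy : y.1 ≤ m), f _ _ hx x.2 = f _ _ hy y.2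
      iseqv := by
        refine ⟨fun x => ⟨x.1, le_rfl, le_rfl, rfl⟩,
          fun ⟨m, hx, hy, e⟩ => ⟨m, hy, hx, e.symm⟩, ?_⟩
        rintro x y z ⟨m, hx, hy, e⟩ ⟨n, hy', hz, e'⟩
        refine ⟨max m n, hx.trans (le_max_left _ _), hz.trans (le_max_right _ _), ?_⟩
        have trans : ∀ {i l p} (h : i ≤ l) (h' : l ≤ p) (x : T i),
            f i p (h.trans h') x = f l p h' (f i l h x) :=
          fun h h' x => Nat.leRecOn_trans h h' x
        rw [trans hx (le_max_left m n), trans hz (le_max_right m n), e, ← e',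
          ← trans, ← trans] }
  refine ⟨Quotient s, fun k v => Quotient.mk s ⟨k, v⟩, fun k v => ?_, fun k v w h => ?_,
    fun y => ?_⟩
  · refine Quotient.sound ⟨k + 1, le_rfl, Nat.le_succ k, ?_⟩
    exact (hself _ _).trans (Nat.leRecOn_succ' (C := T) (next := fun {k} => ι k) v).symm
  · obtain ⟨m, hx, hy, e⟩ := Quotient.exact h
    exact hf _ _ _ e
  · obtain ⟨⟨k, v⟩, rfl⟩ := Quotient.exists_rep y
    exact ⟨k, v, rfl⟩

section Cocone

variable {T : ℕ → Type} {ι : ∀ k, T k → T (k + 1)} {Y : Type} {j : ∀ k, T k → Y}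

/-- A point of a cocone that is reached at some stage is reached at all later stages. -/
theorem exists_rep_of_le (hι : ∀ k v, j (k + 1) (ι k v) = j k v) {k : ℕ} (v : T k) {m : ℕ}
    (h : k ≤ m) : ∃ w, j m w = j k v := by
  induction m, h using Nat.le_induction with
  | base => exact ⟨v, rfl⟩
  | succ m _ ih =>
    obtain ⟨w, hw⟩ := ih
    exact ⟨ι m w, (hι m w).trans hw⟩

theorem exists_rep_eventually (hι : ∀ k v, j (k + 1) (ι k v) = j k v)
    (surj : ∀ y, ∃ k v, j k v = y) (y : Y) : ∃ k, ∀ m, k ≤ m → ∃ w, j m w = y := by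
  obtain ⟨k, v, rfl⟩ := surj y
  exact ⟨k, fun m hm => exists_rep_of_le hι v hm⟩

end Cocone

variable {V α : Type}

/-- A system of inclusions of colored edge-indexed graphs has a direct limit as soon as
every vertex whose edges change at some stage is `safe`, i.e. has unchanged edges, from
then on. -/
theorem exists_isDirLimit (F : ℕ → EIG V α) (ι : ∀ k, (F k).Vert → (F (k + 1)).Vert)
    (inj : ∀ k, Function.Injective (ι k))
    (hcol : ∀ k v, (F (k + 1)).col (ι k v) = (F k).col v)
    (N : ℕ) (safe : ∀ k, (F k).Vert → Prop)
    (safe_succ : ∀ k, N ≤ k → ∀ u, safe k u → safe (k + 1) (ι k u))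
    (idx_safe : ∀ k, N ≤ k → ∀ u, safe k u →
      ∀ v, (F (k + 1)).idx (ι k u) (ι k v) = (F k).idx u v)
    (safe_or : ∀ k, N ≤ k → ∀ u, safe (k + 1) (ι k u) ∨
      ∀ v, (F (k + 1)).idx (ι k u) (ι k v) = (F k).idx u v) :
    ∃ Y, IsDirLimit F ι Y := by
  obtain ⟨Y, j, hι, jinj, surj⟩ := exists_colimit (fun k => (F k).Vert) ι inj
  have colstep : ∀ k l (v : (F k).Vert) (w : (F (k + l)).Vert), j k v = j (k + l) w →
      (F (k + l)).col w = (F k).col v := by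
    intro k l
    induction l with
    | zero => intro v w h; rw [jinj _ h]; rfl
    | succ l ih =>
      intro v w h
      obtain ⟨w', hw'⟩ := exists_rep_of_le hι v (Nat.le_add_right k l)
      have : ι (k + l) w' = w := jinj (k + l + 1) ((hι _ _).trans (hw'.trans h))
      rw [← ih v w' hw'.symm, ← hcol (k + l) w', this]
      rfl
  have coleq : ∀ k l (v : (F k).Vert) (w : (F l).Vert), j k v = j l w →
      (F k).col v = (F l).col w := by
    intro k l v w h
    rcases Nat.le_total k l with hkl | hkl
    · obtain ⟨i, rfl⟩ := Nat.exists_eq_add_of_le hkl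
      exact (colstep k i v w h).symm
    · obtain ⟨i, rfl⟩ := Nat.exists_eq_add_of_le hkl
      exact colstep l i w v h.symm
  have stable : ∀ y z : Y, ∃ c N, ∀ k, N ≤ k → ∀ v w, j k v = y → j k w = z →
      (F k).idx v w = c := by
    intro y z
    obtain ⟨ky, hy⟩ := exists_rep_eventually hι surj y
    obtain ⟨kz, hz⟩ := exists_rep_eventually hι surj z
    have key : ∀ k0, N ≤ k0 → ky ≤ k0 → kz ≤ k0 →
        (∀ k, k0 ≤ k → ∀ v w, j k v = y → j k w = z →
          (F (k + 1)).idx (ι k v) (ι k w) = (F k).idx v w) →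
        ∃ c N, ∀ k, N ≤ k → ∀ v w, j k v = y → j k w = z → (F k).idx v w = c := by
      intro k0 h0 h1 h2 hk
      obtain ⟨v0, hv0⟩ := hy k0 h1
      obtain ⟨w0, hw0⟩ := hz k0 h2
      refine ⟨(F k0).idx v0 w0, k0, fun k hkk => ?_⟩
      induction k, hkk using Nat.le_induction with
      | base =>
        intro v w hv hw
        rw [jinj _ (hv.trans hv0.symm), jinj _ (hw.trans hw0.symm)]
      | succ k hkk ih =>
        intro v w hv hw
        obtain ⟨v', hv'⟩ := hy k (h1.trans hkk)
        obtain ⟨w', hw'⟩ := hz k (h2.trans hkk)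
        have ev : ι k v' = v := jinj (k + 1) ((hι _ _).trans (hv'.trans hv.symm))
        have ew : ι k w' = w := jinj (k + 1) ((hι _ _).trans (hw'.trans hw.symm))
        rw [← ev, ← ew, hk k hkk v' w' hv' hw', ih v' w' hv' hw']
    by_cases hs : ∃ k, N ≤ k ∧ ky ≤ k ∧ kz ≤ k ∧ ∃ v, j k v = y ∧ safe k v
    · obtain ⟨k, h0, h1, h2, v0, hv0, hsv⟩ := hs
      have hsafe : ∀ m, k ≤ m → ∃ v, j m v = y ∧ safe m v := by
        intro m hm
        induction m, hm using Nat.le_induction with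
        | base => exact ⟨v0, hv0, hsv⟩
        | succ m hm ih =>
          obtain ⟨v, hv, hs⟩ := ih
          exact ⟨ι m v, (hι _ _).trans hv, safe_succ m (h0.trans hm) v hs⟩
      refine key k h0 h1 h2 fun m hm v w hv hw => ?_
      obtain ⟨v', hv', hs'⟩ := hsafe m hm
      obtain rfl := jinj m (hv.trans hv'.symm)
      exact idx_safe m (h0.trans hm) v hs' w
    · push Not at hs
      refine key (max N (max ky kz)) (by omega) (by omega) (by omega) fun m hm v w hv hw => ?_
      rcases safe_or m (by omega) v with h | h
      · exact absurd h (hs (m + 1) (by omega) (by omega) (by omega) _ ((hι _ _).trans hv))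
      · exact h w
  choose c hc using stable
  choose kr vr hr using surj
  refine ⟨{ Vert := Y, idx := c, col := fun y => (F (kr y)).col (vr y), lab := fun _ => ∅ },
    j, hι, jinj, fun y => ⟨kr y, vr y, hr y⟩, fun k v => coleq _ _ _ _ (hr _), fun y z => ?_⟩
  obtain ⟨N, hN⟩ := hc y z
  exact ⟨N, fun k hk v w hv hw => (hN k hk v w hv hw).symm⟩

/-- Direct limits of systems that are isomorphic from some stage on are isomorphic. -/
theorem IsDirLimit.nonempty_iso {F F' : ℕ → EIG V α}
    {ι : ∀ k, (F k).Vert → (F (k + 1)).Vert} {ι' : ∀ k, (F' k).Vert → (F' (k + 1)).Vert}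
    {Y Y' : EIG V α} (hY : IsDirLimit F ι Y) (hY' : IsDirLimit F' ι' Y') (N : ℕ)
    (e : ∀ k, N ≤ k → EIGIso (F k) (F' k))
    (he : ∀ k (h : N ≤ k) v,
      (e (k + 1) (Nat.le_succ_of_le h)).e (ι k v) = ι' k ((e k h).e v)) :
    Nonempty (EIGIso Y Y') := by
  obtain ⟨j, hι, jinj, surj, hcol, hidx⟩ := hY
  obtain ⟨j', hι', jinj', surj', hcol', hidx'⟩ := hY'
  have total : ∀ y, ∃ y', ∃ k0, N ≤ k0 ∧ ∀ k (_ : k0 ≤ k) (h : N ≤ k), ∃ v, j k v = y ∧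
      j' k ((e k h).e v) = y' := by
    intro y
    obtain ⟨k0, hk0⟩ := exists_rep_eventually hι surj y
    obtain ⟨v, hv⟩ := hk0 (max N k0) (le_max_right _ _)
    refine ⟨j' _ ((e _ (le_max_left N k0)).e v), max N k0, le_max_left _ _, fun k hk => ?_⟩
    induction k, hk using Nat.le_induction with
    | base => exact fun _ => ⟨v, hv, rfl⟩
    | succ k hk ih =>
      intro h
      obtain ⟨w, hw, hw'⟩ := ih ((le_max_left _ _).trans hk)
      exact ⟨ι k w, (hι _ _).trans hw, by
        rw [he k ((le_max_left _ _).trans hk) w, hι', hw']⟩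
  choose f k0 hk0 hf using total
  have finj : Function.Injective f := by
    intro y z h
    obtain ⟨v, hv, hv'⟩ := hf y (max (k0 y) (k0 z)) (le_max_left _ _)
      ((hk0 y).trans (le_max_left _ _))
    obtain ⟨w, hw, hw'⟩ := hf z (max (k0 y) (k0 z)) (le_max_right _ _)
      ((hk0 y).trans (le_max_left _ _))
    have := (e _ _).e.injective (jinj' _ (hv'.trans (h.trans hw'.symm)))
    exact hv.symm.trans ((congrArg _ this).trans hw)
  have fsurj : Function.Surjective f := by
    intro y'
    obtain ⟨k1, hk1⟩ := exists_rep_eventually hι' surj' y'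
    obtain ⟨k, hNk, v', hv'⟩ : ∃ k, N ≤ k ∧ ∃ v', j' k v' = y' :=
      ⟨max N k1, le_max_left _ _, hk1 _ (le_max_right _ _)⟩
    obtain ⟨v, rfl⟩ := (e k hNk).e.surjective v'
    have rep : ∀ m (_ : k ≤ m) (h : N ≤ m), ∃ w, j m w = j k v ∧ j' m ((e m h).e w) = y' := by
      intro m hm
      induction m, hm using Nat.le_induction with
      | base => exact fun _ => ⟨v, rfl, hv'⟩
      | succ m hm ih =>
        intro h
        obtain ⟨w, hw, hw'⟩ := ih (hNk.trans hm)
        exact ⟨ι m w, (hι _ _).trans hw, by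
          rw [he m (hNk.trans hm) w, hι', hw']⟩
    refine ⟨j k v, ?_⟩
    obtain ⟨w, hw, hw'⟩ := rep (max k (k0 (j k v))) (le_max_left _ _)
      (hNk.trans (le_max_left _ _))
    obtain ⟨x, hx, hx'⟩ := hf (j k v) (max k (k0 (j k v))) (le_max_right _ _)
      (hNk.trans (le_max_left _ _))
    rw [← hx', ← hw', jinj _ (hx.trans hw.symm)]
  refine ⟨⟨Equiv.ofBijective f ⟨finj, fsurj⟩, fun y z => ?_, fun y => ?_⟩⟩
  · obtain ⟨N1, h1⟩ := hidx y z
    obtain ⟨N2, h2⟩ := hidx' (f y) (f z)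
    set k := max (max N1 N2) (max (k0 y) (k0 z))
    have hNk : N ≤ k := (hk0 y).trans ((le_max_left _ _).trans (le_max_right _ _))
    obtain ⟨v, hv, hv'⟩ := hf y k (by omega) hNk
    obtain ⟨w, hw, hw'⟩ := hf z k (by omega) hNk
    change Y'.idx (f y) (f z) = Y.idx y z
    rw [h1 k (by omega) v w hv hw,
      h2 k (by omega) _ _ hv' hw', (e k hNk).idx_eq]
  · obtain ⟨v, hv, hv'⟩ := hf y (k0 y) le_rfl (hk0 y)
    change Y'.col (f y) = Y.col y
    rw [← hv', hcol', (e _ _).col_eq, ← hcol, hv]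

end Sturm

namespace Sturm

/-! ## Foldings onto a segment -/

/-- `p` folds the graph with adjacency `E` onto the segment `[-m, M]`, locally surjectively
except possibly at `0`. -/
structure IsFolding {W : Type} (E : W → W → Prop) (M m : ℤ) (p : W → ℤ) : Prop where
  le : ∀ y, p y ≤ M
  ge : ∀ y, -m ≤ p y
  lip : ∀ y z, E y z → p y ≤ p z + 1 ∧ p z ≤ p y + 1
  dn_pos : ∀ y, 0 < p y → ∃ z, E y z ∧ p z = p y - 1
  dn_neg : ∀ y, p y < 0 → ∃ z, E y z ∧ p z = p y + 1
  up_pos : ∀ y, 0 < p y → p y < M → ∃ z, E y z ∧ p z = p y + 1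
  up_neg : ∀ y, p y < 0 → -m < p y → ∃ z, E y z ∧ p z = p y - 1
  zero : ∀ y, p y = 0 → ∃ z, E y z ∧ (p z = 1 ∨ p z = -1)

theorem IsFolding.neg {W : Type} {E : W → W → Prop} {M m : ℤ} {p : W → ℤ}
    (h : IsFolding E M m p) : IsFolding E m M (fun y => -p y) where
  le y := by have := h.ge y; omega
  ge y := by have := h.le y; omega
  lip y z hyz := by have := h.lip y z hyz; omega
  dn_pos y hy := by
    obtain ⟨z, hz, e⟩ := h.dn_neg y (by omega)
    exact ⟨z, hz, by omega⟩
  dn_neg y hy := by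
    obtain ⟨z, hz, e⟩ := h.dn_pos y (by omega)
    exact ⟨z, hz, by omega⟩
  up_pos y hy hy' := by
    obtain ⟨z, hz, e⟩ := h.up_neg y (by omega) (by omega)
    exact ⟨z, hz, by omega⟩
  up_neg y hy hy' := by
    obtain ⟨z, hz, e⟩ := h.up_pos y (by omega) (by omega)
    exact ⟨z, hz, by omega⟩
  zero y hy := by
    obtain ⟨z, hz, e⟩ := h.zero y (by omega)
    exact ⟨z, hz, by omega⟩

/-- The folding of `[-b, M + b + e]` onto `[-b, M]`. -/
def foldPos (b e t : ℤ) : ℤ := if b + e ≤ t then t - b - e else if 0 ≤ t then t - b else -t - b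

theorem IsFolding.foldPos {W : Type} {E : W → W → Prop} {M b e : ℤ} {p : W → ℤ}
    (hM : 1 ≤ M) (hb : 1 ≤ b) (he : e = 0 ∨ e = 1) (h : IsFolding E (M + b + e) b p) :
    IsFolding E M b (fun y => foldPos b e (p y)) where
  le y := by have := h.le y; have := h.ge y; unfold Sturm.foldPos; split_ifs <;> omega
  ge y := by have := h.le y; have := h.ge y; unfold Sturm.foldPos; split_ifs <;> omega
  lip y z hyz := by
    have := h.lip y z hyz
    have := h.ge y
    have := h.ge z
    unfold Sturm.foldPos; split_ifs <;> omega
  dn_pos y hy := by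
    have h1 := h.ge y
    have hp : b + e < p y := by
      unfold Sturm.foldPos at hy; split_ifs at hy <;> omega
    obtain ⟨z, hz, hpz⟩ := h.dn_pos y (by omega)
    exact ⟨z, hz, by unfold Sturm.foldPos; split_ifs <;> omega⟩
  dn_neg y hy := by
    have h1 := h.ge y
    have hp : p y < b ∧ -b < p y := by
      unfold Sturm.foldPos at hy; split_ifs at hy <;> omega
    rcases lt_trichotomy (p y) 0 with h0 | h0 | h0
    · obtain ⟨z, hz, hpz⟩ := h.up_neg y (by omega) (by omega)
      exact ⟨z, hz, by unfold Sturm.foldPos; split_ifs <;> omega⟩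
    · obtain ⟨z, hz, hpz⟩ := h.zero y (by omega)
      exact ⟨z, hz, by unfold Sturm.foldPos; split_ifs <;> omega⟩
    · obtain ⟨z, hz, hpz⟩ := h.up_pos y (by omega) (by omega)
      exact ⟨z, hz, by unfold Sturm.foldPos; split_ifs <;> omega⟩
  up_pos y hy hy' := by
    have h1 := h.ge y
    have hp : b + e < p y ∧ p y < M + b + e := by
      unfold Sturm.foldPos at hy hy'; split_ifs at hy hy' <;> omega
    obtain ⟨z, hz, hpz⟩ := h.up_pos y (by omega) (by omega)
    exact ⟨z, hz, by unfold Sturm.foldPos; split_ifs <;> omega⟩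
  up_neg y hy hy' := by
    have h1 := h.ge y
    have hp : p y < b ∧ -b < p y ∧ p y ≠ 0 := by
      unfold Sturm.foldPos at hy hy'; split_ifs at hy hy' <;> omega
    rcases lt_or_gt_of_ne hp.2.2 with h0 | h0
    · obtain ⟨z, hz, hpz⟩ := h.dn_neg y (by omega)
      exact ⟨z, hz, by unfold Sturm.foldPos; split_ifs <;> omega⟩
    · obtain ⟨z, hz, hpz⟩ := h.dn_pos y (by omega)
      exact ⟨z, hz, by unfold Sturm.foldPos; split_ifs <;> omega⟩
  zero y hy := by
    have h1 := h.ge y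
    have hp : p y = b + e ∨ p y = b ∨ p y = -b := by
      unfold Sturm.foldPos at hy; split_ifs at hy <;> omega
    have hc : (p y = b + 1 ∧ e = 1) ∨ p y = b ∨ p y = -b := by omega
    rcases hc with h0 | h0 | h0
    · obtain ⟨z, hz, hpz⟩ := h.up_pos y (by omega) (by omega)
      exact ⟨z, hz, by unfold Sturm.foldPos; split_ifs <;> omega⟩
    · obtain ⟨z, hz, hpz⟩ := h.dn_pos y (by omega)
      exact ⟨z, hz, by unfold Sturm.foldPos; split_ifs <;> omega⟩
    · obtain ⟨z, hz, hpz⟩ := h.dn_neg y (by omega)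
      exact ⟨z, hz, by unfold Sturm.foldPos; split_ifs <;> omega⟩

/-- A folding is determined by its composition with `foldPos`. -/
theorem IsFolding.eq_of_foldPos_eq {W : Type} {E : W → W → Prop} {M b e : ℤ} {p q : W → ℤ}
    (hM : 1 ≤ M) (hb : 1 ≤ b) (he : e = 0 ∨ e = 1) (hp : IsFolding E (M + b + e) b p)
    (hq : IsFolding E (M + b + e) b q)
    (h : ∀ y, Sturm.foldPos b e (p y) = Sturm.foldPos b e (q y)) (y : W) : p y = q y := by
  have pos : ∀ y, b + e < p y → p y = q y := by
    intro y hy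
    have := h y
    have := hq.ge y
    simp only [Sturm.foldPos] at *
    split_ifs at * <;> omega
  have pos' : ∀ y, b + e < q y → p y = q y := by
    intro y hy
    have := h y
    have := hp.ge y
    simp only [Sturm.foldPos] at *
    split_ifs at * <;> omega
  have cases0 : ∀ y, (p y = q y ∧ (b + e < p y)) ∨
      ((p y = b ∨ p y = b + e ∨ p y = -b) ∧ (q y = b ∨ q y = b + e ∨ q y = -b)) ∨
      (-b < p y ∧ p y < b ∧ (p y = q y ∨ p y = - q y)) := by
    intro y
    have := h y
    have := hp.ge y
    have := hq.ge y
    simp only [Sturm.foldPos] at *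
    split_ifs at * <;> omega
  have top : ∀ y, p y = b + e → p y = q y := by
    intro y hy
    obtain ⟨z, hz, hpz⟩ := hp.up_pos y (by omega) (by omega)
    have := pos z (by omega)
    have := hq.lip y z hz
    have := cases0 y
    omega
  have top' : ∀ y, q y = b + e → p y = q y := by
    intro y hy
    obtain ⟨z, hz, hpz⟩ := hq.up_pos y (by omega) (by omega)
    have := pos' z (by omega)
    have := hp.lip y z hz
    have := cases0 y
    omega
  have mid : ∀ y, p y = b → p y = q y := by
    intro y hy
    by_cases hy' : p y = b + e
    · exact top y hy'
    obtain ⟨z, hz, hpz⟩ := hp.up_pos y (by omega) (by omega)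
    have := top z (by omega)
    have := top' y
    have := hq.lip y z hz
    have := cases0 y
    omega
  have mid' : ∀ y, q y = b → p y = q y := by
    intro y hy
    by_cases hy' : q y = b + e
    · exact top' y hy'
    obtain ⟨z, hz, hpz⟩ := hq.up_pos y (by omega) (by omega)
    have := top' z (by omega)
    have := top y
    have := hp.lip y z hz
    have := cases0 y
    omega
  have low : ∀ n : ℕ, ∀ y, |p y| = b - n → p y = q y := by
    intro n
    induction n with
    | zero =>
      intro y hy
      have h0 : p y = b ∨ p y = -b := by
        rcases abs_cases (p y) with h | h <;> push_cast at hy <;> omega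
      rcases h0 with h0 | h0
      · exact mid y h0
      · have := cases0 y
        have := mid' y
        have := top' y
        omega
    | succ n ih =>
      intro y hy
      have hc := cases0 y
      push_cast at hy
      rcases lt_trichotomy (p y) 0 with h0 | h0 | h0
      · rw [abs_of_neg h0] at hy
        obtain ⟨z, hz, hpz⟩ := hp.up_neg y (by omega) (by omega)
        have := ih z (by rw [abs_of_neg (by omega)]; omega)
        have := hq.lip y z hz
        omega
      · omega
      · rw [abs_of_pos h0] at hy
        obtain ⟨z, hz, hpz⟩ := hp.up_pos y (by omega) (by omega)
        have := ih z (by rw [abs_of_pos (by omega)]; omega)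
        have := hq.lip y z hz
        omega
  rcases cases0 y with h0 | h0 | h0
  · exact h0.1
  · by_cases hm : |p y| = b
    · exact low 0 y (by simpa using hm)
    · refine top y ?_
      rcases abs_cases (p y) with h | h <;> omega
  · refine low (b - |p y|).toNat y ?_
    rcases abs_cases (p y) with h | h <;> omega

/-- The folding of labels induced by a step extending the `s`-side. -/
def foldLabel (s : Bool) (b e t : ℤ) : ℤ := if s = true then foldPos b e t else -foldPos b e (-t)

theorem IsFolding.foldLabel {W : Type} {E : W → W → Prop} {len len' : Bool → ℤ} {s : Bool}
    {e : ℤ} {p : W → ℤ} (hlen : ∀ x, 1 ≤ len x) (he : e = 0 ∨ e = 1)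
    (hs : len' s = len s + len (!s) + e) (hns : len' (!s) = len (!s))
    (h : IsFolding E (len' true) (len' false) p) :
    IsFolding E (len true) (len false) (fun y => foldLabel s (len (!s)) e (p y)) := by
  cases s
  · simp only [Bool.not_false] at hs hns ⊢
    rw [hs, hns] at h
    have := (h.neg.foldPos (hlen _) (hlen _) he).neg
    simpa [Sturm.foldLabel] using this
  · simp only [Bool.not_true] at hs hns ⊢
    rw [hs, hns] at h
    simpa [Sturm.foldLabel] using h.foldPos (hlen _) (hlen _) he

theorem IsFolding.eq_of_foldLabel_eq {W : Type} {E : W → W → Prop} {len len' : Bool → ℤ}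
    {s : Bool} {e : ℤ} {p q : W → ℤ} (hlen : ∀ x, 1 ≤ len x) (he : e = 0 ∨ e = 1)
    (hs : len' s = len s + len (!s) + e) (hns : len' (!s) = len (!s))
    (hp : IsFolding E (len' true) (len' false) p) (hq : IsFolding E (len' true) (len' false) q)
    (h : ∀ y, Sturm.foldLabel s (len (!s)) e (p y) = Sturm.foldLabel s (len (!s)) e (q y))
    (y : W) : p y = q y := by
  cases s
  · simp only [Bool.not_false] at hs hns h
    rw [hs, hns] at hp hq
    have := IsFolding.eq_of_foldPos_eq (hlen _) (hlen _) he hp.neg hq.neg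
      (fun y => by simpa [Sturm.foldLabel] using h y) y
    omega
  · simp only [Bool.not_true] at hs hns h
    rw [hs, hns] at hp hq
    exact IsFolding.eq_of_foldPos_eq (hlen _) (hlen _) he hp hq
      (fun y => by simpa [Sturm.foldLabel] using h y) y

/-- At the vertices labeled `t`, the indices of the edges leading towards `0` add up to `n`,
there being at most two of them. -/
def InwardWeight {W : Type} (idx : W → W → ℕ) (p : W → ℤ) (t : ℤ) (n : ℕ) : Prop :=
  ∀ y, p y = t → ∀ z, y ≠ z → 0 < idx y z → |p z| = |t| - 1 →
    (idx y z = n ∨ ∃ z', z' ≠ z ∧ y ≠ z' ∧ 0 < idx y z' ∧ |p z'| = |t| - 1) ∧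
    ∀ z', z' ≠ z → y ≠ z' → 0 < idx y z' → |p z'| = |t| - 1 → idx y z + idx y z' = n

theorem IsFolding.abs_le {W : Type} {E : W → W → Prop} {M m : ℤ} {p q : W → ℤ}
    (hp : IsFolding E M m p) (hq : IsFolding E M m q) (h0 : ∀ y, p y = 0 → q y = 0) (y : W) :
    |q y| ≤ |p y| := by
  have : ∀ n : ℕ, ∀ y, |p y| = n → |q y| ≤ n := by
    intro n
    induction n with
    | zero =>
      intro y hy
      have := h0 y (abs_eq_zero.1 (by simpa using hy))
      simp [this]
    | succ n ih =>
      intro y hy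
      push_cast at hy ⊢
      rcases lt_trichotomy (p y) 0 with h1 | h1 | h1
      · rw [abs_of_neg h1] at hy
        obtain ⟨z, hz, hpz⟩ := hp.dn_neg y h1
        have := _root_.abs_le.1 (ih z (by rw [abs_of_nonpos (by omega)]; omega))
        have := hq.lip y z hz
        exact _root_.abs_le.2 (by omega)
      · rw [h1] at hy; simp at hy; omega
      · rw [abs_of_pos h1] at hy
        obtain ⟨z, hz, hpz⟩ := hp.dn_pos y h1
        have := _root_.abs_le.1 (ih z (by rw [abs_of_nonneg (by omega)]; omega))
        have := hq.lip y z hz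
        exact _root_.abs_le.2 (by omega)
  have h := this (p y).natAbs y (Int.abs_eq_natAbs _)
  rwa [← Int.abs_eq_natAbs] at h

/-- Two foldings with the same zeros are equal, if the two ends of the segment can be told
apart by their distances to `0` or by their inward weights. -/
theorem IsFolding.eq_of_zeros {W : Type} {idx : W → W → ℕ} {M m : ℤ} {p q : W → ℤ}
    (hp : IsFolding (fun y z => y ≠ z ∧ 0 < idx y z) M m p)
    (hq : IsFolding (fun y z => y ≠ z ∧ 0 < idx y z) M m q)
    (h0 : ∀ y, p y = 0 ↔ q y = 0)
    (hW : M ≤ m → ∃ n n', n ≠ n' ∧ InwardWeight idx p M n ∧ InwardWeight idx q M n ∧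
      InwardWeight idx p (-M) n' ∧ InwardWeight idx q (-M) n') (y : W) : p y = q y := by
  have main : ∀ p q : W → ℤ, IsFolding (fun y z => y ≠ z ∧ 0 < idx y z) M m p →
      IsFolding (fun y z => y ≠ z ∧ 0 < idx y z) M m q → (∀ y, |p y| = |q y|) →
      (M ≤ m → ∃ n n', n ≠ n' ∧ InwardWeight idx p M n ∧ InwardWeight idx q (-M) n') →
      ∀ y, 0 < p y → p y ≠ - q y := by
    intro p q hp hq habs hW y hy hpq
    have walk : ∀ i : ℕ, p y + i ≤ M → ∃ z, p z = p y + i ∧ q z = - p z := by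
      intro i
      induction i with
      | zero => exact fun _ => ⟨y, by simp, by omega⟩
      | succ i ih =>
        intro hi
        push_cast at hi
        obtain ⟨z, hz, hz'⟩ := ih (by omega)
        obtain ⟨x, hx, hx'⟩ := hp.up_pos z (by omega) (by omega)
        have := hq.lip z x hx
        refine ⟨x, by push_cast; omega, ?_⟩
        rcases abs_eq_abs.1 (habs x) with h | h <;> omega
    have := hp.le y
    obtain ⟨z, hz, hz'⟩ := walk (M - p y).toNat (by omega)
    have hzM : p z = M := by omega
    have := hq.ge z
    obtain ⟨n, n', hn, h1, h2⟩ := hW (by omega)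
    obtain ⟨x, hx, hx'⟩ := hp.dn_pos z (by omega)
    have ax : |p x| = |M| - 1 := by rw [abs_of_nonneg (by omega), abs_of_nonneg (by omega)]; omega
    obtain ⟨h3, h4⟩ := h1 z hzM x hx.1 hx.2 ax
    obtain ⟨h5, h6⟩ := h2 z (by omega) x hx.1 hx.2 (by rw [← habs, abs_neg, ax])
    by_cases hex : ∃ x', x' ≠ x ∧ z ≠ x' ∧ 0 < idx z x' ∧ |p x'| = |M| - 1
    · obtain ⟨x', hx1, hx2, hx3, hx4⟩ := hex
      have e1 := h4 x' hx1 hx2 hx3 hx4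
      have e2 := h6 x' hx1 hx2 hx3 (by rw [← habs, abs_neg, hx4])
      exact hn (e1.symm.trans e2)
    · have e1 := h3.resolve_right hex
      have e2 := h5.resolve_right (by simpa only [← habs, abs_neg] using hex)
      exact hn (e1.symm.trans e2)
  have habs : ∀ y, |p y| = |q y| := fun y =>
    le_antisymm (hq.abs_le hp (fun y => (h0 y).2) y) (hp.abs_le hq (fun y => (h0 y).1) y)
  have m1 := main p q hp hq habs (fun h => by
    obtain ⟨n, n', hn, h1, h2, h3, h4⟩ := hW h
    exact ⟨n, n', hn, h1, h4⟩) y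
  have m2 := main q p hq hp (fun y => (habs y).symm) (fun h => by
    obtain ⟨n, n', hn, h1, h2, h3, h4⟩ := hW h
    exact ⟨n, n', hn, h2, h3⟩) y
  rcases abs_eq_abs.1 (habs y) with h | h <;> omega

end Sturm

namespace Sturm

variable {V α : Type}

/-! ## Towers of paths -/

/-- `X` is a path of length `L`, with vertices numbered by `r`. -/
structure IsPath (X : EIG V α) (L : ℤ) (r : X.Vert → ℤ) : Prop where
  inj : ∀ u v, r u = r v → u = v
  nonneg : ∀ u, 0 ≤ r u
  le : ∀ u, r u ≤ L
  surj : ∀ t, 0 ≤ t → t ≤ L → ∃ u, r u = t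
  adj : ∀ u v, u ≠ v → (0 < X.idx u v ↔ r u = r v + 1 ∨ r v = r u + 1)

/-- Adjacency by an edge of positive index. -/
def PosAdj (X : EIG V α) (u v : X.Vert) : Prop := u ≠ v ∧ 0 < X.idx u v

theorem IsPath.posAdj {X : EIG V α} {L : ℤ} {r : X.Vert → ℤ} (h : IsPath X L r) {u v : X.Vert} :
    PosAdj X u v ↔ r u = r v + 1 ∨ r v = r u + 1 := by
  refine ⟨fun h' => (h.adj u v h'.1).1 h'.2, fun h' => ?_⟩
  have hne : u ≠ v := by rintro rfl; omega
  exact ⟨hne, (h.adj u v hne).2 h'⟩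

/-- Vertices of the `A`-side get positive labels, those of the `B`-side negative ones. -/
def sgnLabel (x : Bool) (t : ℤ) : ℤ := if x = true then t else -t

theorem sgnLabel_eq_zero {x : Bool} {t : ℤ} : sgnLabel x t = 0 ↔ t = 0 := by
  cases x <;> simp [sgnLabel]

/-- Two sequences of paths, where at each step the `s n`-side is extended by the other one,
glued at the vertices numbered `0` when `e n = 0` and joined by an edge when `e n = 1`.
All vertices are numbered from the common end vertex. -/
structure IsTower (T : ℕ → Bool → EIG V α)
    (sel : ∀ n x y, (T n x).Vert → (T (n + 1) y).Vert) (s : ℕ → Bool) (e : ℕ → ℤ)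
    (len : ℕ → Bool → ℤ) (r : ∀ n x, (T n x).Vert → ℤ) : Prop where
  e_eq : ∀ n, e n = 0 ∨ e n = 1
  len_pos : ∀ n x, 1 ≤ len n x
  len_s : ∀ n, len (n + 1) (s n) = len n (s n) + len n (!s n) + e n
  len_ns : ∀ n, len (n + 1) (!s n) = len n (!s n)
  path : ∀ n x, IsPath (T n x) (len n x) (r n x)
  r_s : ∀ n v, r (n + 1) (s n) (sel n (s n) (s n) v) = len n (!s n) + e n + r n (s n) v
  r_ns : ∀ n y v, r (n + 1) y (sel n (!s n) y v) = len n (!s n) - r n (!s n) v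
  col_sel : ∀ n x y, y = s n ∨ y = x → ∀ v, (T (n + 1) y).col (sel n x y v) = (T n x).col v
  surj : ∀ n y u, ∃ x v, (y = s n ∨ y = x) ∧ sel n x y v = u
  idx_sel : ∀ n x y, y = s n ∨ y = x → ∀ u v,
    (y ≠ s n ∨ r n x u ≠ 0 ∨ (e n = 1 ∧ r n x v ≠ 0)) →
    (T (n + 1) y).idx (sel n x y u) (sel n x y v) = (T n x).idx u v
  glue : ∀ n, e n = 0 → ∀ u u' w w', r n (s n) u = 0 → r n (s n) u' = 1 →
    r n (!s n) w = 0 → r n (!s n) w' = 1 →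
    (T (n + 1) (s n)).idx (sel n (s n) (s n) u) (sel n (s n) (s n) u') +
      (T (n + 1) (s n)).idx (sel n (!s n) (s n) w) (sel n (!s n) (s n) w') =
      (T n (!s n)).idx w w'

namespace IsTower

variable {T : ℕ → Bool → EIG V α} {sel : ∀ n x y, (T n x).Vert → (T (n + 1) y).Vert}
  {s : ℕ → Bool} {e : ℕ → ℤ} {len : ℕ → Bool → ℤ} {r : ∀ n x, (T n x).Vert → ℤ}

theorem r_sel (h : IsTower T sel s e len r) (n : ℕ) {x y : Bool} (hxy : y = s n ∨ y = x) :
    (y = s n ∧ x = s n ∧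
      ∀ v, r (n + 1) y (sel n x y v) = len n (!s n) + e n + r n x v) ∨
    (x = !s n ∧ ∀ v, r (n + 1) y (sel n x y v) = len n (!s n) - r n x v) := by
  by_cases hx : x = s n
  · left
    have hy : y = s n := by rcases hxy with h | h; exacts [h, h.trans hx]
    subst hx
    subst hy
    exact ⟨rfl, rfl, h.r_s n⟩
  · right
    have hx' : x = !s n := by revert hx; cases x <;> cases s n <;> simp
    subst hx'
    exact ⟨rfl, h.r_ns n y⟩

theorem sel_injective (h : IsTower T sel s e len r) (n : ℕ) {x y : Bool}
    (hxy : y = s n ∨ y = x) : Function.Injective (sel n x y) := by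
  intro u v huv
  apply (h.path n x).inj
  rcases h.r_sel n hxy with ⟨_, _, h1⟩ | ⟨_, h1⟩ <;>
  · have hu := h1 u
    have hv := h1 v
    rw [huv] at hu
    omega

theorem posAdj_sel (h : IsTower T sel s e len r) (n : ℕ) {x y : Bool}
    (hxy : y = s n ∨ y = x) (u v : (T n x).Vert) :
    PosAdj (T (n + 1) y) (sel n x y u) (sel n x y v) ↔ PosAdj (T n x) u v := by
  rw [(h.path (n + 1) y).posAdj, (h.path n x).posAdj]
  rcases h.r_sel n hxy with ⟨_, _, h1⟩ | ⟨_, h1⟩ <;>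
  · rw [h1 u, h1 v]
    omega

theorem len_succ (h : IsTower T sel s e len r) (n : ℕ) (y : Bool) :
    (y = s n ∧ len (n + 1) y = len n y + len n (!s n) + e n) ∨
    (y ≠ s n ∧ y = (!s n) ∧ len (n + 1) y = len n (!s n)) := by
  by_cases hy : y = s n
  · exact .inl ⟨hy, by rw [hy, h.len_s n]⟩
  · have hy' : y = !s n := by revert hy; cases y <;> cases s n <;> simp
    exact .inr ⟨hy, hy', by rw [hy', h.len_ns n]⟩

/-- The vertex `u` is not an end vertex. -/
def Interior (len : ℕ → Bool → ℤ) (r : ∀ n x, (T n x).Vert → ℤ) (n : ℕ) (x : Bool)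
    (u : (T n x).Vert) : Prop := 0 < r n x u ∧ r n x u < len n x

theorem interior_sel (h : IsTower T sel s e len r) (n : ℕ) {x y : Bool}
    (hxy : y = s n ∨ y = x) {u : (T n x).Vert} (hu : Interior len r n x u) :
    Interior len r (n + 1) y (sel n x y u) := by
  unfold Interior at *
  have he := h.e_eq n
  have h1 := h.len_pos n x
  have h2 := h.len_pos n y
  have h3 := h.len_pos n (!s n)
  rcases h.r_sel n hxy with ⟨hy, hx, h1⟩ | ⟨hx, h1⟩ <;> rw [h1 u] <;>
    rcases h.len_succ n y with ⟨hy', h4⟩ | ⟨hy', hy'', h4⟩ <;> rw [h4]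
  · have : len n x = len n y := by rw [hx, hy]
    omega
  · exact absurd hy hy'
  · have : len n x = len n (!s n) := by rw [hx]
    omega
  · have : len n x = len n (!s n) := by rw [hx]
    omega

theorem interior_of_glued (h : IsTower T sel s e len r) (n : ℕ) (x : Bool)
    {u : (T n x).Vert} (hu : r n x u = 0) :
    Interior len r (n + 1) (s n) (sel n x (s n) u) := by
  unfold Interior at *
  have he := h.e_eq n
  have h1 := h.len_pos n (s n)
  have h3 := h.len_pos n (!s n)
  rw [h.len_s n]
  rcases h.r_sel n (x := x) (Or.inl rfl) with ⟨_, hx, h1⟩ | ⟨hx, h1⟩ <;> rw [h1 u, hu] <;> omega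

theorem exists_limit (h : IsTower T sel s e len r) {β : ℕ → Bool}
    (hβ : ∀ n, β (n + 1) = s n ∨ β (n + 1) = β n) :
    (∀ n u, Interior len r n (β n) u →
      Interior len r (n + 1) (β (n + 1)) (sel n (β n) (β (n + 1)) u)) ∧
    (∀ n u, Interior len r n (β n) u → ∀ v,
      (T (n + 1) (β (n + 1))).idx (sel n (β n) (β (n + 1)) u) (sel n (β n) (β (n + 1)) v) =
        (T n (β n)).idx u v) ∧
    (∀ n u, Interior len r (n + 1) (β (n + 1)) (sel n (β n) (β (n + 1)) u) ∨
      ∀ v, (T (n + 1) (β (n + 1))).idx (sel n (β n) (β (n + 1)) u)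
        (sel n (β n) (β (n + 1)) v) = (T n (β n)).idx u v) := by
  refine ⟨fun n u hu => h.interior_sel n (hβ n) hu, fun n u hu v =>
    h.idx_sel n _ _ (hβ n) u v (.inr (.inl hu.1.ne')), fun n u => ?_⟩
  by_cases hs : β (n + 1) = s n
  · by_cases hr : r n (β n) u = 0
    · left
      rw [hs]
      exact h.interior_of_glued n _ hr
    · exact .inr fun v => h.idx_sel n _ _ (hβ n) u v (.inr (.inl hr))
  · exact .inr fun v => h.idx_sel n _ _ (hβ n) u v (.inl hs)

/-! ### Labels -/

/-- The folding of level `n + 1` labels to level `n` labels. -/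
def fold (s : ℕ → Bool) (e : ℕ → ℤ) (len : ℕ → Bool → ℤ) (n : ℕ) (t : ℤ) : ℤ :=
  foldLabel (s n) (len n (!s n)) (e n) t

/-- The folding of level `m` labels to level `n` labels, for `n ≤ m`. -/
def foldIter (s : ℕ → Bool) (e : ℕ → ℤ) (len : ℕ → Bool → ℤ) (n : ℕ) : ℕ → ℤ → ℤ
  | 0, t => t
  | m + 1, t => if n ≤ m then foldIter s e len n m (fold s e len m t) else t

theorem foldIter_self (n : ℕ) (t : ℤ) : foldIter s e len n n t = t := by
  cases n <;> simp [foldIter]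

theorem foldIter_succ {n m : ℕ} (h : n ≤ m) (t : ℤ) :
    foldIter s e len n (m + 1) t = foldIter s e len n m (fold s e len m t) := by
  simp [foldIter, h]

theorem foldIter_eq_fold {n m : ℕ} (h : n + 1 ≤ m) (t : ℤ) :
    foldIter s e len n m t = fold s e len n (foldIter s e len (n + 1) m t) := by
  induction m, h using Nat.le_induction generalizing t with
  | base => rw [foldIter_self, foldIter_succ le_rfl, foldIter_self]
  | succ m hm ih => rw [foldIter_succ (Nat.le_of_succ_le hm), foldIter_succ hm, ih]

/-- The level `n` label of a vertex at stage `m`. -/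
def label (s : ℕ → Bool) (e : ℕ → ℤ) (len : ℕ → Bool → ℤ) (r : ∀ n x, (T n x).Vert → ℤ)
    (n m : ℕ) (x : Bool) (v : (T m x).Vert) : ℤ :=
  foldIter s e len n m (sgnLabel x (r m x v))

theorem label_self (n : ℕ) (x : Bool) (v : (T n x).Vert) :
    label s e len r n n x v = sgnLabel x (r n x v) := foldIter_self _ _

theorem fold_sgnLabel (h : IsTower T sel s e len r) (n : ℕ) {x y : Bool}
    (hxy : y = s n ∨ y = x) (v : (T n x).Vert) :
    fold s e len n (sgnLabel y (r (n + 1) y (sel n x y v))) = sgnLabel x (r n x v) := by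
  have he := h.e_eq n
  have h1 := (h.path n x).nonneg v
  have h2 := (h.path n x).le v
  unfold fold foldLabel
  rcases h.r_sel n hxy with ⟨hy, hx, h3⟩ | ⟨hx, h3⟩ <;> rw [h3 v]
  · subst hx
    subst hy
    have := h.len_pos n (!s n)
    unfold sgnLabel foldPos
    split_ifs <;> omega
  · rw [← hx]
    have hs : s n = !x := by simp [hx]
    rw [hs] at hxy ⊢
    clear h3 hs hx
    revert hxy
    unfold sgnLabel foldPos
    rcases x with _ | _ <;> rcases y with _ | _ <;> simp <;> split_ifs <;> omega

theorem label_sel (h : IsTower T sel s e len r) {n m : ℕ} (hnm : n ≤ m) {x y : Bool}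
    (hxy : y = s m ∨ y = x) (v : (T m x).Vert) :
    label s e len r n (m + 1) y (sel m x y v) = label s e len r n m x v := by
  unfold label
  rw [foldIter_succ hnm, h.fold_sgnLabel m hxy]

theorem isFolding_sgnLabel (h : IsTower T sel s e len r) (n : ℕ) (x : Bool) :
    IsFolding (PosAdj (T n x)) (len n true) (len n false)
      (fun v => sgnLabel x (r n x v)) := by
  have hp := h.path n x
  have ht := h.len_pos n true
  have hf := h.len_pos n false
  have step : ∀ u t, 0 ≤ t → t ≤ len n x → (t = r n x u - 1 ∨ t = r n x u + 1) →
      ∃ z, PosAdj (T n x) u z ∧ r n x z = t := by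
    intro u t h0 h1 h2
    obtain ⟨z, hz⟩ := hp.surj t h0 h1
    exact ⟨z, hp.posAdj.2 (by omega), hz⟩
  have lip : ∀ u v, PosAdj (T n x) u v → r n x u ≤ r n x v + 1 ∧ r n x v ≤ r n x u + 1 := by
    intro u v huv
    have := hp.posAdj.1 huv
    omega
  have dn : ∀ u, 0 < r n x u → ∃ z, PosAdj (T n x) u z ∧ r n x z = r n x u - 1 :=
    fun u hu => step u _ (by omega) (by have := hp.le u; omega) (.inl rfl)
  have up : ∀ u, r n x u < len n x → ∃ z, PosAdj (T n x) u z ∧ r n x z = r n x u + 1 :=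
    fun u hu => step u _ (by have := hp.nonneg u; omega) (by omega) (.inr rfl)
  cases x
  · constructor <;> simp only [sgnLabel, Bool.false_eq_true, if_false]
    · intro u; have := hp.nonneg u; omega
    · intro u; have := hp.le u; omega
    · intro u v huv; have := lip u v huv; omega
    · intro u hu; have := hp.nonneg u; omega
    · intro u hu; obtain ⟨z, hz, hz'⟩ := dn u (by omega); exact ⟨z, hz, by omega⟩
    · intro u hu; have := hp.nonneg u; omega
    · intro u _ hu; obtain ⟨z, hz, hz'⟩ := up u (by omega); exact ⟨z, hz, by omega⟩
    · intro u hu; obtain ⟨z, hz, hz'⟩ := up u (by omega); exact ⟨z, hz, by omega⟩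
  · constructor <;> simp only [sgnLabel, if_true]
    · intro u; exact hp.le u
    · intro u; have := hp.nonneg u; omega
    · intro u v huv; exact lip u v huv
    · exact dn
    · intro u hu; have := hp.nonneg u; omega
    · exact fun u _ => up u
    · intro u hu; have := hp.nonneg u; omega
    · intro u hu; obtain ⟨z, hz, hz'⟩ := up u (by omega); exact ⟨z, hz, by omega⟩

theorem isFolding_fold (h : IsTower T sel s e len r) (n : ℕ) {W : Type} {E : W → W → Prop}
    {p : W → ℤ} (hp : IsFolding E (len (n + 1) true) (len (n + 1) false) p) :
    IsFolding E (len n true) (len n false) (fun y => fold s e len n (p y)) :=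
  hp.foldLabel (h.len_pos n) (h.e_eq n) (h.len_s n) (h.len_ns n)

theorem isFolding_foldIter (h : IsTower T sel s e len r) {n m : ℕ} (hnm : n ≤ m) {W : Type}
    {E : W → W → Prop} {p : W → ℤ} (hp : IsFolding E (len m true) (len m false) p) :
    IsFolding E (len n true) (len n false) (fun y => foldIter s e len n m (p y)) := by
  induction m, hnm using Nat.le_induction generalizing p with
  | base => simpa only [foldIter_self] using hp
  | succ m hm ih =>
    simp only [foldIter_succ hm]
    exact ih (h.isFolding_fold m hp)

theorem isFolding_label (h : IsTower T sel s e len r) {n m : ℕ} (hnm : n ≤ m) (x : Bool) :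
    IsFolding (PosAdj (T m x)) (len n true) (len n false) (label s e len r n m x) :=
  h.isFolding_foldIter hnm (h.isFolding_sgnLabel m x)

theorem col_iff_label (h : IsTower T sel s e len r) {b : α}
    (h0 : ∀ x v, (T 0 x).col v = b ↔ r 0 x v = 0) (m : ℕ) (x : Bool) (v : (T m x).Vert) :
    (T m x).col v = b ↔ label s e len r 0 m x v = 0 := by
  induction m generalizing x with
  | zero => rw [label_self, sgnLabel_eq_zero, h0]
  | succ m ih =>
    obtain ⟨y, w, hxy, rfl⟩ := h.surj m x v
    rw [h.col_sel m y x hxy, h.label_sel (Nat.zero_le m) hxy, ih]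

theorem inwardWeight_label (h : IsTower T sel s e len r) {t : ℤ} (ht : t ≠ 0) {n : ℕ}
    (h0 : ∀ x, InwardWeight (T 0 x).idx (label s e len r 0 0 x) t n) (m : ℕ) (x : Bool) :
    InwardWeight (T m x).idx (label s e len r 0 m x) t n := by
  induction m generalizing x with
  | zero => exact h0 x
  | succ m ih =>
    have inw : ∀ x (u : (T m x).Vert), label s e len r 0 m x u = t →
        ∃ z, PosAdj (T m x) u z ∧ |label s e len r 0 m x z| = |t| - 1 := by
      intro x u hu
      have hf := h.isFolding_label (Nat.zero_le m) x
      rcases lt_or_gt_of_ne ht with h1 | h1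
      · obtain ⟨z, hz, hz'⟩ := hf.dn_neg u (by omega)
        exact ⟨z, hz, by rw [abs_of_nonpos (by omega), abs_of_neg h1]; omega⟩
      · obtain ⟨z, hz, hz'⟩ := hf.dn_pos u (by omega)
        exact ⟨z, hz, by rw [abs_of_nonneg (by omega), abs_of_pos h1]; omega⟩
    have inw1 : ∀ x (u : (T m x).Vert), r m x u = 0 → label s e len r 0 m x u = t →
        ∃ z, r m x z = 1 ∧ PosAdj (T m x) u z ∧ |label s e len r 0 m x z| = |t| - 1 ∧
          (T m x).idx u z = n := by
      intro x u hu hut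
      obtain ⟨z, hz, hz'⟩ := inw x u hut
      have hr := (h.path m x).posAdj.1 hz
      have hnn := (h.path m x).nonneg z
      refine ⟨z, by omega, hz, hz', (ih x u hut z hz.1 hz.2 hz').1.resolve_right ?_⟩
      rintro ⟨z', h1, h2, h3, h4⟩
      have hr' := (h.path m x).posAdj.1 ⟨h2, h3⟩
      have hnn' := (h.path m x).nonneg z'
      exact h1 ((h.path m x).inj _ _ (by omega))
    -- inward edges at `sel u` come from inward edges at `u`
    have transfer : ∀ x y (hxy : y = s m ∨ y = x) (u : (T m x).Vert),
        label s e len r 0 m x u = t →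
        (∀ z, PosAdj (T (m + 1) y) (sel m x y u) z →
          |label s e len r 0 (m + 1) y z| = |t| - 1 → ∃ v, sel m x y v = z ∧
            (T (m + 1) y).idx (sel m x y u) z = (T m x).idx u v) →
        ∀ z, sel m x y u ≠ z → 0 < (T (m + 1) y).idx (sel m x y u) z →
          |label s e len r 0 (m + 1) y z| = |t| - 1 →
          ((T (m + 1) y).idx (sel m x y u) z = n ∨ ∃ z', z' ≠ z ∧ sel m x y u ≠ z' ∧
            0 < (T (m + 1) y).idx (sel m x y u) z' ∧
            |label s e len r 0 (m + 1) y z'| = |t| - 1) ∧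
          ∀ z', z' ≠ z → sel m x y u ≠ z' → 0 < (T (m + 1) y).idx (sel m x y u) z' →
            |label s e len r 0 (m + 1) y z'| = |t| - 1 →
            (T (m + 1) y).idx (sel m x y u) z + (T (m + 1) y).idx (sel m x y u) z' = n := by
      intro x y hxy u hut hall z h1 h2 h3
      obtain ⟨v, rfl, hidx⟩ := hall z ⟨h1, h2⟩ h3
      have hadj := (h.posAdj_sel m hxy u v).1 ⟨h1, h2⟩
      rw [h.label_sel (Nat.zero_le m) hxy] at h3
      obtain ⟨ha, hb⟩ := ih x u hut v hadj.1 hadj.2 h3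
      refine ⟨?_, fun z' h1' h2' h3' h4' => ?_⟩
      · rw [hidx]
        rcases ha with ha | ⟨z', h1', h2', h3', h4'⟩
        · exact .inl ha
        · have := (h.posAdj_sel m hxy u z').2 ⟨h2', h3'⟩
          exact .inr ⟨sel m x y z', fun hc => h1' (h.sel_injective m hxy hc), this.1, this.2,
            by rwa [h.label_sel (Nat.zero_le m) hxy]⟩
      · obtain ⟨v', rfl, hidx'⟩ := hall z' ⟨h2', h3'⟩ h4'
        have hadj' := (h.posAdj_sel m hxy u v').1 ⟨h2', h3'⟩
        rw [h.label_sel (Nat.zero_le m) hxy] at h4'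
        rw [hidx, hidx']
        exact hb v' (fun hc => h1' (by rw [hc])) hadj'.1 hadj'.2 h4'
    intro y0 hy0
    obtain ⟨x', u, hxy, rfl⟩ := h.surj m x y0
    rw [h.label_sel (Nat.zero_le m) hxy] at hy0
    by_cases hxs : x = s m
    swap
    · have hx' : x = x' := hxy.resolve_left hxs
      refine transfer x' x hxy u hy0 fun z hz _ => ?_
      obtain ⟨x'', v, hxy', rfl⟩ := h.surj m x z
      obtain rfl : x' = x'' := by rw [← hx', ← hxy'.resolve_left hxs]
      exact ⟨v, rfl, h.idx_sel m _ _ hxy u v (.inl hxs)⟩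
    have hpath := h.path (m + 1) x
    have he := h.e_eq m
    have hls := h.len_pos m (s m)
    have hlns := h.len_pos m (!s m)
    have glued : e m = 0 → ∀ x' (_ : x = s m ∨ x = x') (u : (T m x').Vert) w, r m x' u = 0 →
        r m (!x') w = 0 → sel m x' x u = sel m (!x') x w := by
      intro he0 x' hxy u w hu hw
      apply hpath.inj
      rcases h.r_sel m hxy with ⟨_, hx, h3⟩ | ⟨hx, h3⟩ <;>
        rcases h.r_sel m (x := !x') (Or.inl hxs) with ⟨_, hx', h4⟩ | ⟨hx', h4⟩ <;>
        rw [h3, h4] <;> omega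
    have same : ∀ x' (_ : x = s m ∨ x = x') (u : (T m x').Vert) z,
        PosAdj (T (m + 1) x) (sel m x' x u) z →
        (∃ v, sel m x' x v = z) ∨ (r m x' u = 0 ∧ ((e m = 1 ∧ ∃ w, r m (!x') w = 0 ∧
          sel m (!x') x w = z) ∨ (e m = 0 ∧ ∃ w, r m (!x') w = 1 ∧ sel m (!x') x w = z))) := by
      intro x' hxy u z hz
      obtain ⟨x'', v, hxy', rfl⟩ := h.surj m x z
      by_cases hx : x'' = x'
      · subst hx; exact .inl ⟨v, rfl⟩
      obtain rfl : x'' = !x' := by revert hx; cases x'' <;> cases x' <;> simp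
      have hr := hpath.posAdj.1 hz
      have h1 := (h.path m x').nonneg u
      have h2 := (h.path m (!x')).nonneg v
      have hl := h.len_pos m x'
      by_cases hgl : e m = 0 ∧ r m (!x') v = 0
      · obtain ⟨v', hv'⟩ := (h.path m x').surj 0 le_rfl (by omega)
        exact .inl ⟨v', glued hgl.1 x' hxy v' v hv' hgl.2⟩
      right
      rcases h.r_sel m hxy with ⟨_, hx, h3⟩ | ⟨hx, h3⟩ <;>
        rcases h.r_sel m hxy' with ⟨_, hx', h4⟩ | ⟨hx', h4⟩ <;> rw [h3, h4] at hr
      · exfalso; revert hx hx'; cases x' <;> cases s m <;> simp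
      · rcases he with he | he
        · exact ⟨by omega, .inr ⟨he, v, by omega, rfl⟩⟩
        · exact ⟨by omega, .inl ⟨he, v, by omega, rfl⟩⟩
      · rcases he with he | he
        · exact ⟨by omega, .inr ⟨he, v, by omega, rfl⟩⟩
        · exact ⟨by omega, .inl ⟨he, v, by omega, rfl⟩⟩
      · exfalso; revert hx hx'; cases x' <;> cases s m <;> simp
    have label0 : ∀ x' (u : (T m x').Vert) x'' (w : (T m x'').Vert), r m x' u = 0 →
        r m x'' w = 0 → label s e len r 0 m x' u = label s e len r 0 m x'' w := by
      intro x' u x'' w hu hw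
      unfold label
      rw [sgnLabel_eq_zero.2 hu, sgnLabel_eq_zero.2 hw]
    rcases eq_or_ne (r m x' u) 0 with hu | hu
    swap
    · refine transfer x' x hxy u hy0 fun z hz _ => ?_
      rcases same x' hxy u z hz with ⟨v, rfl⟩ | hc
      · exact ⟨v, rfl, h.idx_sel m _ _ hxy u v (.inr (.inl hu))⟩
      · exact absurd hc.1 hu
    rcases he with he | he
    swap
    · refine transfer x' x hxy u hy0 fun z hz hzt => ?_
      rcases same x' hxy u z hz with ⟨v, rfl⟩ | ⟨_, ⟨_, w, hw, rfl⟩ | ⟨he', _⟩⟩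
      · refine ⟨v, rfl, h.idx_sel m _ _ hxy u v (.inr (.inr ⟨he, ?_⟩))⟩
        have := (h.path m x').posAdj.1 ((h.posAdj_sel m hxy u v).1 hz)
        omega
      · rw [h.label_sel (Nat.zero_le m) (.inl hxs), ← label0 x' u _ w hu hw, hy0] at hzt
        omega
      · omega
    -- the glued vertex
    obtain ⟨w, hw⟩ := (h.path m (!x')).surj 0 le_rfl (by have := h.len_pos m (!x'); omega)
    obtain ⟨u', hu', hadj, hut, hun⟩ := inw1 x' u hu hy0
    obtain ⟨w', hw', hadj', hwt, hwn⟩ := inw1 (!x') w hw ((label0 _ _ _ _ hw hu).trans hy0)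
    have hg := glued he x' hxy u w hu hw
    have hxy' : x = s m ∨ x = !x' := .inl hxs
    have hsum : (T (m + 1) x).idx (sel m x' x u) (sel m x' x u') +
        (T (m + 1) x).idx (sel m x' x u) (sel m (!x') x w') = n := by
      have hgl := h.glue m he
      rw [← hxs] at hgl
      have hx' : x = x' ∨ x = !x' := by cases x <;> cases x' <;> simp
      rcases hx' with rfl | rfl
      · have := hgl u u' w w' hu hu' hw hw'
        rwa [← hg, hwn] at this
      · rw [Bool.not_not] at hgl
        have := hgl w w' u u' hw hw' hu hu'
        rwa [← hg, hun, add_comm] at this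
    have hne : sel m x' x u' ≠ sel m (!x') x w' := by
      intro hc
      have hc' := congrArg (r (m + 1) x) hc
      rcases h.r_sel m hxy with ⟨_, hx, h3⟩ | ⟨hx, h3⟩ <;>
        rcases h.r_sel m hxy' with ⟨_, hx', h4⟩ | ⟨hx', h4⟩ <;> rw [h3, h4] at hc'
      · revert hx hx'; cases x' <;> cases s m <;> simp
      · omega
      · omega
      · revert hx hx'; cases x' <;> cases s m <;> simp
    have hu2 := (h.posAdj_sel m hxy u u').2 hadj
    have hw2 := (h.posAdj_sel m hxy' w w').2 hadj'
    rw [← hg] at hw2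
    have hut2 : |label s e len r 0 (m + 1) x (sel m x' x u')| = |t| - 1 := by
      rwa [h.label_sel (Nat.zero_le m) hxy]
    have hwt2 : |label s e len r 0 (m + 1) x (sel m (!x') x w')| = |t| - 1 := by
      rwa [h.label_sel (Nat.zero_le m) hxy']
    have all : ∀ z, PosAdj (T (m + 1) x) (sel m x' x u) z →
        z = sel m x' x u' ∨ z = sel m (!x') x w' := by
      intro z hz
      rcases same x' hxy u z hz with ⟨v, rfl⟩ | ⟨_, ⟨he', _⟩ | ⟨_, v, hv, rfl⟩⟩
      · have h1 := (h.path m x').posAdj.1 ((h.posAdj_sel m hxy u v).1 hz)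
        have h2 := (h.path m x').nonneg v
        rw [(h.path m x').inj v u' (by omega)]
        exact .inl rfl
      · omega
      · rw [(h.path m (!x')).inj v w' (by omega)]
        exact .inr rfl
    intro z h1 h2 h3
    rcases all z ⟨h1, h2⟩ with rfl | rfl
    · refine ⟨.inr ⟨_, hne.symm, hw2.1, hw2.2, hwt2⟩, fun z' h1' h2' h3' _ => ?_⟩
      rcases all z' ⟨h2', h3'⟩ with rfl | rfl
      · exact absurd rfl h1'
      · exact hsum
    · refine ⟨.inr ⟨_, hne, hu2.1, hu2.2, hut2⟩, fun z' h1' h2' h3' _ => ?_⟩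
      rcases all z' ⟨h2', h3'⟩ with rfl | rfl
      · rwa [add_comm]
      · exact absurd rfl h1'

end IsTower

end Sturm

namespace Sturm

variable {V α : Type}

namespace IsTower

variable {T : ℕ → Bool → EIG V α} {sel : ∀ n x y, (T n x).Vert → (T (n + 1) y).Vert}
  {s : ℕ → Bool} {e : ℕ → ℤ} {len : ℕ → Bool → ℤ} {r : ∀ n x, (T n x).Vert → ℤ}

/-- The labels of all levels induced on a direct limit of a tower. -/
structure LimitLabels (T : ℕ → Bool → EIG V α) (s : ℕ → Bool) (e : ℕ → ℤ)
    (len : ℕ → Bool → ℤ) (r : ∀ n x, (T n x).Vert → ℤ) (β : ℕ → Bool) (b : α) (Y : EIG V α)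
    (p : ℕ → Y.Vert → ℤ) : Prop where
  nonempty : Nonempty Y.Vert
  folding : ∀ n, IsFolding (PosAdj Y) (len n true) (len n false) (p n)
  fold_eq : ∀ n y, p n y = fold s e len n (p (n + 1) y)
  col_iff : ∀ y, Y.col y = b ↔ p 0 y = 0
  weight : ∀ t, t ≠ 0 → ∀ n, (∀ x, InwardWeight (T 0 x).idx (label s e len r 0 0 x) t n) →
    InwardWeight Y.idx (p 0) t n
  rep : ∀ y, ∃ N, ∃ ρ : ℕ → ℤ, ∀ m, N ≤ m → 0 ≤ ρ m ∧ p m y = sgnLabel (β m) (ρ m) ∧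
    ((0 < ρ m ∧ ρ m < len m (β m)) ∨ (ρ m = 0 ∧ β (m + 1) = s m) →
      0 < ρ (m + 1) ∧ ρ (m + 1) < len (m + 1) (β (m + 1)))

theorem exists_limitLabels (h : IsTower T sel s e len r) {β : ℕ → Bool}
    (hβ : ∀ n, β (n + 1) = s n ∨ β (n + 1) = β n) {b : α}
    (h0 : ∀ x v, (T 0 x).col v = b ↔ r 0 x v = 0) {Y : EIG V α}
    (hY : IsDirLimit (fun m => T m (β m)) (fun m => sel m (β m) (β (m + 1))) Y) :
    ∃ p, LimitLabels T s e len r β b Y p := by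
  obtain ⟨J, hι, jinj, surj, hcol, hidx⟩ := hY
  have reps := exists_rep_eventually hι surj
  have adjstep : ∀ m l (v w : (T m (β m)).Vert) (v' w' : (T (m + l) (β (m + l))).Vert),
      J m v = J (m + l) v' → J m w = J (m + l) w' →
      (PosAdj (T (m + l) (β (m + l))) v' w' ↔ PosAdj (T m (β m)) v w) := by
    intro m l
    induction l with
    | zero => intro v w v' w' hv hw; rw [jinj _ hv, jinj _ hw]; rfl
    | succ l ih =>
      intro v w v' w' hv hw
      obtain ⟨v1, hv1⟩ := exists_rep_of_le hι v (Nat.le_add_right m l)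
      obtain ⟨w1, hw1⟩ := exists_rep_of_le hι w (Nat.le_add_right m l)
      rw [← ih v w v1 w1 hv1.symm hw1.symm, ← h.posAdj_sel (m + l) (hβ (m + l))]
      have ev := jinj (m + l + 1) ((hι _ _).trans (hv1.trans hv))
      have ew := jinj (m + l + 1) ((hι _ _).trans (hw1.trans hw))
      simp only at ev ew
      rw [ev, ew]
      rfl
  have adjY : ∀ m v w, PosAdj Y (J m v) (J m w) ↔ PosAdj (T m (β m)) v w := by
    intro m v w
    obtain ⟨N, hN⟩ := hidx (J m v) (J m w)
    obtain ⟨v', hv'⟩ := exists_rep_of_le hι v (Nat.le_add_right m N)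
    obtain ⟨w', hw'⟩ := exists_rep_of_le hι w (Nat.le_add_right m N)
    have e1 := hN (m + N) (by omega) v' w' hv' hw'
    rw [← adjstep m N v w v' w' hv'.symm hw'.symm]
    unfold PosAdj
    rw [e1, ← hv', ← hw', (jinj (m + N)).ne_iff]
  have labstep : ∀ n m l, n ≤ m → ∀ (v : (T m (β m)).Vert) (w : (T (m + l) (β (m + l))).Vert),
      J m v = J (m + l) w →
      label s e len r n (m + l) _ w = label s e len r n m _ v := by
    intro n m l hnm
    induction l with
    | zero => intro v w hv; rw [jinj _ hv]; rfl
    | succ l ih =>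
      intro v w hv
      obtain ⟨v1, hv1⟩ := exists_rep_of_le hι v (Nat.le_add_right m l)
      have ev := jinj (m + l + 1) ((hι _ _).trans (hv1.trans hv))
      simp only at ev
      rw [← ih v v1 hv1.symm, ← h.label_sel (hnm.trans (Nat.le_add_right m l)) (hβ (m + l)), ev]
      rfl
  have labeq : ∀ n m l, n ≤ m → n ≤ l → ∀ (v : (T m (β m)).Vert) (w : (T l (β l)).Vert),
      J m v = J l w → label s e len r n m _ v = label s e len r n l _ w := by
    intro n m l hm hl v w hvw
    rcases Nat.le_total m l with hml | hml
    · obtain ⟨i, rfl⟩ := Nat.exists_eq_add_of_le hml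
      exact (labstep n m i hm v w hvw).symm
    · obtain ⟨i, rfl⟩ := Nat.exists_eq_add_of_le hml
      exact labstep n l i hl w v hvw.symm
  choose k hk using reps
  choose v hv using hk
  obtain ⟨p, hp⟩ : ∃ p : ℕ → Y.Vert → ℤ, ∀ n m, n ≤ m → ∀ v, p n (J m v) =
      label s e len r n m (β m) v :=
    ⟨fun n y => label s e len r n _ _ (v y (max n (k y)) (le_max_right _ _)),
      fun n m hnm v => labeq _ _ _ (le_max_left _ _) hnm _ _ (hv _ _ _)⟩
  have rep2 : ∀ n y z, ∃ m, n ≤ m ∧ (∃ v, J m v = y) ∧ ∃ w, J m w = z := fun n y z =>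
    ⟨max n (max (k y) (k z)), le_max_left _ _, ⟨_, hv y _ (by omega)⟩, ⟨_, hv z _ (by omega)⟩⟩
  have nbr : ∀ n y, ∃ m, ∃ (hnm : n ≤ m) (v : (T m (β m)).Vert), J m v = y ∧
      p n y = label s e len r n m _ v ∧ ∀ z, PosAdj (T m (β m)) v z →
        ∃ z', PosAdj Y y z' ∧ p n z' = label s e len r n m _ z := by
    intro n y
    obtain ⟨m, hm, ⟨v, rfl⟩, -⟩ := rep2 n y y
    exact ⟨m, hm, v, rfl, hp n m hm v, fun z hz => ⟨J m z, (adjY m v z).2 hz, hp n m hm z⟩⟩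
  refine ⟨p, ⟨?_, fun n => ?_, fun n y => ?_, fun y => ?_, fun t ht n hW => ?_, fun y => ?_⟩⟩
  · obtain ⟨u, _⟩ := (h.path 0 (β 0)).surj 0 le_rfl (by have := h.len_pos 0 (β 0); omega)
    exact ⟨J 0 u⟩
  · constructor
    · intro y
      obtain ⟨m, hm, u, _, hu, hn⟩ := nbr n y
      rw [hu]; exact (h.isFolding_label hm _).le u
    · intro y
      obtain ⟨m, hm, u, _, hu, hn⟩ := nbr n y
      rw [hu]; exact (h.isFolding_label hm _).ge u
    · intro y z hyz
      obtain ⟨m, hm, ⟨u, rfl⟩, ⟨w, rfl⟩⟩ := rep2 n y z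
      rw [hp n m hm, hp n m hm]
      exact (h.isFolding_label hm _).lip u w ((adjY m u w).1 hyz)
    · intro y
      obtain ⟨m, hm, u, _, hu, hn⟩ := nbr n y
      rw [hu]
      intro hy
      obtain ⟨z, hz, hz'⟩ := (h.isFolding_label hm _).dn_pos u hy
      obtain ⟨z', hz1, hz2⟩ := hn z hz
      exact ⟨z', hz1, hz2.trans hz'⟩
    · intro y
      obtain ⟨m, hm, u, _, hu, hn⟩ := nbr n y
      rw [hu]
      intro hy
      obtain ⟨z, hz, hz'⟩ := (h.isFolding_label hm _).dn_neg u hy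
      obtain ⟨z', hz1, hz2⟩ := hn z hz
      exact ⟨z', hz1, hz2.trans hz'⟩
    · intro y
      obtain ⟨m, hm, u, _, hu, hn⟩ := nbr n y
      rw [hu]
      intro hy hy'
      obtain ⟨z, hz, hz'⟩ := (h.isFolding_label hm _).up_pos u hy hy'
      obtain ⟨z', hz1, hz2⟩ := hn z hz
      exact ⟨z', hz1, hz2.trans hz'⟩
    · intro y
      obtain ⟨m, hm, u, _, hu, hn⟩ := nbr n y
      rw [hu]
      intro hy hy'
      obtain ⟨z, hz, hz'⟩ := (h.isFolding_label hm _).up_neg u hy hy'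
      obtain ⟨z', hz1, hz2⟩ := hn z hz
      exact ⟨z', hz1, hz2.trans hz'⟩
    · intro y
      obtain ⟨m, hm, u, _, hu, hn⟩ := nbr n y
      rw [hu]
      intro hy
      obtain ⟨z, hz, hz'⟩ := (h.isFolding_label hm _).zero u hy
      obtain ⟨z', hz1, hz2⟩ := hn z hz
      exact ⟨z', hz1, by rwa [hz2]⟩
  · obtain ⟨m, hm, ⟨u, rfl⟩, -⟩ := rep2 (n + 1) y y
    rw [hp n m (by omega), hp (n + 1) m hm]
    exact foldIter_eq_fold hm _
  · obtain ⟨m, hm, ⟨u, rfl⟩, -⟩ := rep2 0 y y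
    rw [hcol, hp 0 m hm, h.col_iff_label h0]
  · have hWm := h.inwardWeight_label ht hW
    have stage : ∀ y z, PosAdj Y y z → ∃ N, ∀ m, N ≤ m → ∃ u w, J m u = y ∧ J m w = z ∧
        Y.idx y z = (T m (β m)).idx u w ∧ PosAdj (T m (β m)) u w := by
      intro y z hyz
      obtain ⟨N, hN⟩ := hidx y z
      refine ⟨max N (max (k y) (k z)), fun m hm => ?_⟩
      have e1 := hv y m (by omega)
      have e2 := hv z m (by omega)
      refine ⟨_, _, e1, e2, hN m (by omega) _ _ e1 e2, ?_⟩
      rwa [← adjY, e1, e2]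
    intro y hy z h1 h2 h3
    obtain ⟨N, hN⟩ := stage y z ⟨h1, h2⟩
    refine ⟨?_, fun z' h1' h2' h3' h4' => ?_⟩
    · obtain ⟨u, w, rfl, rfl, hi, ha⟩ := hN N le_rfl
      rw [hp 0 N (Nat.zero_le _)] at hy h3
      rw [hi]
      rcases (hWm N _ u hy w ha.1 ha.2 h3).1 with hc | ⟨z', hz1, hz2, hz3, hz4⟩
      · exact .inl hc
      · have := (adjY N u z').2 ⟨hz2, hz3⟩
        exact .inr ⟨J N z', fun hc => hz1 (jinj _ hc), this.1, this.2,
          by rwa [hp 0 N (Nat.zero_le _)]⟩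
    · obtain ⟨N', hN'⟩ := stage y z' ⟨h2', h3'⟩
      obtain ⟨u, w, rfl, rfl, hi, ha⟩ := hN (max N N') (le_max_left _ _)
      obtain ⟨u', w', hu', rfl, hi', ha'⟩ := hN' (max N N') (le_max_right _ _)
      obtain rfl := jinj _ hu'
      rw [hp 0 _ (Nat.zero_le _)] at hy h3 h4'
      rw [hi, hi']
      exact (hWm _ _ u' hy w ha.1 ha.2 h3).2 w' (fun hc => h1' (by rw [hc])) ha'.1 ha'.2 h4'
  · refine ⟨k y, fun m => if hm : k y ≤ m then r m _ (v y m hm) else 0, fun m hm => ?_⟩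
    beta_reduce
    rw [dif_pos hm, dif_pos (Nat.le_succ_of_le hm)]
    have ev : sel m _ _ (v y m hm) = v y (m + 1) (Nat.le_succ_of_le hm) :=
      jinj (m + 1) ((hι _ _).trans ((hv y m hm).trans (hv y (m + 1) _).symm))
    refine ⟨(h.path m _).nonneg _, ?_, ?_⟩
    · conv_lhs => rw [← hv y m hm]
      rw [hp m m le_rfl, label_self]
    · rw [← ev]
      rintro (hc | ⟨hc, hs⟩)
      · exact h.interior_sel m (hβ m) hc
      · have := h.interior_of_glued m _ hc
        rw [← hs] at this
        exact this

theorem eventually_eq_of_iso (h : IsTower T sel s e len r) {b : α}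
    (h0 : ∀ x v, (T 0 x).col v = b ↔ r 0 x v = 0)
    (hW : len 0 true ≤ len 0 false → ∃ n n', n ≠ n' ∧
      (∀ x, InwardWeight (T 0 x).idx (label s e len r 0 0 x) (len 0 true) n) ∧
      ∀ x, InwardWeight (T 0 x).idx (label s e len r 0 0 x) (-len 0 true) n')
    {β β' : ℕ → Bool} (hβ : ∀ n, β (n + 1) = s n ∨ β (n + 1) = β n)
    (hβ' : ∀ n, β' (n + 1) = s n ∨ β' (n + 1) = β' n) {Y Y' : EIG V α}
    (hY : IsDirLimit (fun m => T m (β m)) (fun m => sel m (β m) (β (m + 1))) Y)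
    (hY' : IsDirLimit (fun m => T m (β' m)) (fun m => sel m (β' m) (β' (m + 1))) Y')
    (f : EIGIso Y Y') : ∃ N, ∀ m, N ≤ m → β m = β' m := by
  obtain ⟨p, hp⟩ := h.exists_limitLabels hβ h0 hY
  obtain ⟨q, hq⟩ := h.exists_limitLabels hβ' h0 hY'
  have hadj : ∀ y z, PosAdj Y' (f.e y) (f.e z) ↔ PosAdj Y y z := by
    intro y z
    unfold PosAdj
    rw [f.idx_eq, f.e.injective.ne_iff]
  have hqf : ∀ n, IsFolding (PosAdj Y) (len n true) (len n false) (fun y => q n (f.e y)) := by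
    intro n
    have hn := hq.folding n
    have lift : ∀ {y t}, (∃ z, PosAdj Y' (f.e y) z ∧ q n z = t) →
        ∃ z, PosAdj Y y z ∧ q n (f.e z) = t := by
      rintro y t ⟨z, hz, hz'⟩
      obtain ⟨z, rfl⟩ := f.e.surjective z
      exact ⟨z, (hadj y z).1 hz, hz'⟩
    exact ⟨fun y => hn.le _, fun y => hn.ge _, fun y z hyz => hn.lip _ _ ((hadj y z).2 hyz),
      fun y hy => lift (hn.dn_pos _ hy), fun y hy => lift (hn.dn_neg _ hy),
      fun y hy hy' => lift (hn.up_pos _ hy hy'), fun y hy hy' => lift (hn.up_neg _ hy hy'),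
      fun y hy => by
        obtain ⟨z, hz, hz'⟩ := hn.zero _ hy
        obtain ⟨z, rfl⟩ := f.e.surjective z
        exact ⟨z, (hadj y z).1 hz, hz'⟩⟩
  have hqW : ∀ t n, InwardWeight Y'.idx (q 0) t n →
      InwardWeight Y.idx (fun y => q 0 (f.e y)) t n := by
    intro t n hw y hy z h1 h2 h3
    obtain ⟨ha, hb⟩ := hw (f.e y) hy (f.e z) (f.e.injective.ne h1) (by rwa [f.idx_eq]) h3
    rw [f.idx_eq] at ha
    refine ⟨ha.imp_right ?_, fun z' h1' h2' h3' h4' => ?_⟩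
    · rintro ⟨z', hz1, hz2, hz3, hz4⟩
      obtain ⟨z', rfl⟩ := f.e.surjective z'
      exact ⟨z', fun hc => hz1 (by rw [hc]), fun hc => hz2 (by rw [hc]),
        by rwa [f.idx_eq] at hz3, hz4⟩
    · have := hb (f.e z') (f.e.injective.ne h1') (f.e.injective.ne h2') (by rwa [f.idx_eq]) h4'
      rwa [f.idx_eq, f.idx_eq] at this
  have hpq : ∀ n y, p n y = q n (f.e y) := by
    intro n
    induction n with
    | zero =>
      refine IsFolding.eq_of_zeros (hp.folding 0) (hqf 0) (fun y => ?_) fun hle => ?_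
      · rw [← hp.col_iff, ← hq.col_iff, f.col_eq]
      · have hl := h.len_pos 0 true
        obtain ⟨n, n', hn, h1, h2⟩ := hW hle
        exact ⟨n, n', hn, hp.weight _ (by omega) n h1, hqW _ _ (hq.weight _ (by omega) n h1),
          hp.weight _ (by omega) n' h2, hqW _ _ (hq.weight _ (by omega) n' h2)⟩
    | succ n ih =>
      refine (hp.folding (n + 1)).eq_of_foldLabel_eq (h.len_pos n) (h.e_eq n) (h.len_s n)
        (h.len_ns n) (hqf (n + 1)) fun y => ?_
      exact (hp.fold_eq n y).symm.trans ((ih y).trans (hq.fold_eq n _))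
  obtain ⟨y⟩ := hp.nonempty
  obtain ⟨N, ρ, hρ⟩ := hp.rep y
  obtain ⟨N', ρ', hρ'⟩ := hq.rep (f.e y)
  have heq : ∀ m, N ≤ m → N' ≤ m → sgnLabel (β m) (ρ m) = sgnLabel (β' m) (ρ' m) := by
    intro m hm hm'
    rw [← (hρ m hm).2.1, hpq, (hρ' m hm').2.1]
  by_cases hex : ∃ m, max N N' ≤ m ∧ β m ≠ β' m
  swap
  · push Not at hex
    exact ⟨_, hex⟩
  obtain ⟨m, hm, hne⟩ := hex
  have hz : ρ m = 0 ∧ ρ' m = 0 := by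
    have h1 := heq m (by omega) (by omega)
    have h2 := (hρ m (by omega)).1
    have h3 := (hρ' m (by omega)).1
    unfold sgnLabel at h1
    revert h1 hne
    cases β m <;> cases β' m <;> simp <;> omega
  have hs : β (m + 1) = s m ∨ β' (m + 1) = s m := by
    have h1 := hβ m
    have h2 := hβ' m
    revert h1 h2 hne
    cases β m <;> cases β' m <;> cases β (m + 1) <;> cases β' (m + 1) <;> cases s m <;> simp
  refine ⟨m + 1, fun i hi => ?_⟩
  rcases hs with hs | hs
  · have pos : 0 < ρ i ∧ ρ i < len i (β i) := by
      induction i, hi using Nat.le_induction with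
      | base => exact (hρ m (by omega)).2.2 (.inr ⟨hz.1, hs⟩)
      | succ i hi ih => exact (hρ i (by omega)).2.2 (.inl ih)
    have h1 := heq i (by omega) (by omega)
    have h3 := (hρ' i (by omega)).1
    unfold sgnLabel at h1
    revert h1
    cases β i <;> cases β' i <;> simp <;> omega
  · have pos : 0 < ρ' i ∧ ρ' i < len i (β' i) := by
      induction i, hi using Nat.le_induction with
      | base => exact (hρ' m (by omega)).2.2 (.inr ⟨hz.2, hs⟩)
      | succ i hi ih => exact (hρ' i (by omega)).2.2 (.inl ih)
    have h1 := heq i (by omega) (by omega)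
    have h3 := (hρ i (by omega)).1
    unfold sgnLabel at h1
    revert h1
    cases β i <;> cases β' i <;> simp <;> omega

end IsTower

end Sturm

namespace Sturm

variable {V α : Type}

/-! ## Concatenations of paths -/

/-- The reversed numbering of a path. -/
theorem IsPath.reverse {X : EIG V α} {L : ℤ} {r : X.Vert → ℤ} (h : IsPath X L r) :
    IsPath X L (fun u => L - r u) where
  inj u v huv := h.inj u v (by omega)
  nonneg u := by have := h.le u; omega
  le u := by have := h.nonneg u; omega
  surj t h0 h1 := by
    obtain ⟨u, hu⟩ := h.surj (L - t) (by omega) (by omega)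
    exact ⟨u, by omega⟩
  adj u v huv := by rw [h.adj u v huv]; omega

/-- `Z` is the path obtained by gluing (`e = 0`) or joining (`e = 1`) the paths `X` and `Y`
at the vertices numbered `0`. -/
structure IsPathConcat (X Y Z : EIG V α) (iX : X.Vert → Z.Vert) (iY : Y.Vert → Z.Vert)
    (rX : X.Vert → ℤ) (rY : Y.Vert → ℤ) (rZ : Z.Vert → ℤ) (n m e : ℤ) : Prop where
  e_eq : e = 0 ∨ e = 1
  path : IsPath Z (n + m + e) rZ
  rZ_left : ∀ u, rZ (iX u) = m + e + rX u
  rZ_right : ∀ w, rZ (iY w) = m - rY w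
  surj : ∀ z, (∃ u, iX u = z) ∨ ∃ w, iY w = z
  col_left : ∀ u, Z.col (iX u) = X.col u
  col_right : ∀ w, Z.col (iY w) = Y.col w
  idx_left : ∀ u u', (rX u ≠ 0 ∨ (e = 1 ∧ rX u' ≠ 0)) → Z.idx (iX u) (iX u') = X.idx u u'
  idx_right : ∀ w w', (rY w ≠ 0 ∨ (e = 1 ∧ rY w' ≠ 0)) → Z.idx (iY w) (iY w') = Y.idx w w'
  glue : e = 0 → ∀ u u' w w', rX u = 0 → rX u' = 1 → rY w = 0 → rY w' = 1 →
    Z.idx (iX u) (iX u') + Z.idx (iY w) (iY w') = Y.idx w w'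

theorem isPathConcat_concatIJ {X Y : EIG V α} {n m : ℤ} {rX : X.Vert → ℤ} {rY : Y.Vert → ℤ}
    (hX : IsPath X n rX) (hY : IsPath Y m rY) {v : X.Vert} {v' : Y.Vert} (hv : rX v = 0)
    (hv' : rY v' = 0) {i j : ℕ} (hi : 1 ≤ i) (hj : 1 ≤ j) :
    IsPathConcat X Y (concatIJ X Y v v' i j) Sum.inl Sum.inr rX rY
      (Sum.elim (fun u => m + 1 + rX u) (fun w => m - rY w)) n m 1 := by
  have zX : ∀ u, u = v ↔ rX u = 0 := fun u => ⟨fun h => h ▸ hv, fun h => hX.inj _ _ (by omega)⟩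
  have zY : ∀ u, u = v' ↔ rY u = 0 := fun u => ⟨fun h => h ▸ hv', fun h => hY.inj _ _ (by omega)⟩
  constructor
  · exact .inr rfl
  · constructor
    · rintro (u | u) (w | w) h <;> simp only [Sum.elim_inl, Sum.elim_inr] at h
      · rw [hX.inj u w (by omega)]
      · have := hX.nonneg u; have := hY.nonneg w; omega
      · have := hX.nonneg w; have := hY.nonneg u; omega
      · rw [hY.inj u w (by omega)]
    · rintro (u | u) <;> simp only [Sum.elim_inl, Sum.elim_inr]
      · have := hX.nonneg u; have := hY.nonneg v'; have := hY.le v'; omega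
      · have := hY.le u; omega
    · rintro (u | u) <;> simp only [Sum.elim_inl, Sum.elim_inr]
      · have := hX.le u; omega
      · have := hY.nonneg u; have := hX.nonneg v; have := hX.le v; omega
    · intro t h0 h1
      by_cases ht : t ≤ m
      · obtain ⟨w, hw⟩ := hY.surj (m - t) (by omega) (by omega)
        exact ⟨.inr w, by simp only [Sum.elim_inr]; omega⟩
      · obtain ⟨w, hw⟩ := hX.surj (t - m - 1) (by omega) (by omega)
        exact ⟨.inl w, by simp only [Sum.elim_inl]; omega⟩
    · rintro (u | u) (w | w) h <;> simp only [Sum.elim_inl, Sum.elim_inr, concatIJ]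
      · have hne : u ≠ w := fun hc => h (by rw [hc])
        rw [if_neg (fun hc => hne (hc.1.trans hc.2.symm)), hX.adj u w hne]
        omega
      · have := hX.nonneg u
        have := hY.nonneg w
        rw [zX, zY]
        split_ifs <;> omega
      · have := hX.nonneg w
        have := hY.nonneg u
        rw [zX, zY]
        split_ifs <;> omega
      · have hne : u ≠ w := fun hc => h (by rw [hc])
        rw [if_neg (fun hc => hne (hc.1.trans hc.2.symm)), hY.adj u w hne]
        omega
  · exact fun u => rfl
  · exact fun u => rfl
  · rintro (u | u)
    · exact .inl ⟨u, rfl⟩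
    · exact .inr ⟨u, rfl⟩
  · exact fun u => rfl
  · exact fun u => rfl
  · intro u u' h
    simp only [concatIJ]
    rw [if_neg]
    rw [zX, zX]
    omega
  · intro u u' h
    simp only [concatIJ]
    rw [if_neg]
    rw [zY, zY]
    omega
  · intro h; omega

theorem isPathConcat_concatI {X Y : EIG V α} {n m : ℤ} {rX : X.Vert → ℤ} {rY : Y.Vert → ℤ}
    (hX : IsPath X n rX) (hY : IsPath Y m rY) {v : X.Vert} {v' : Y.Vert} (hv : rX v = 0)
    (hv' : rY v' = 0) (hcol : X.col v = Y.col v') {i : ℕ} (hi : 1 ≤ i)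
    (hi' : ∀ w, rY w = 1 → i < Y.idx v' w) :
    IsPathConcat X Y (concatI X Y v v' i) Sum.inl
      (fun w => if h : w ≠ v' then Sum.inr ⟨w, h⟩ else Sum.inl v) rX rY
      (Sum.elim (fun u => m + rX u) (fun w => m - rY w.1)) n m 0 := by
  have zX : ∀ u, u = v ↔ rX u = 0 := fun u => ⟨fun h => h ▸ hv, fun h => hX.inj _ _ (by omega)⟩
  have zY : ∀ u, u = v' ↔ rY u = 0 := fun u => ⟨fun h => h ▸ hv', fun h => hY.inj _ _ (by omega)⟩
  have pY : ∀ w : {w : Y.Vert // w ≠ v'}, 1 ≤ rY w.1 := fun w => by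
    have := hY.nonneg w.1
    have := (zY w.1).not.1 w.2
    omega
  constructor
  · exact .inl rfl
  · constructor
    · rintro (u | u) (w | w) h <;> simp only [Sum.elim_inl, Sum.elim_inr] at h
      · rw [hX.inj u w (by omega)]
      · have := hX.nonneg u; have := pY w; omega
      · have := hX.nonneg w; have := pY u; omega
      · rw [Subtype.ext (hY.inj u.1 w.1 (by omega))]
    · rintro (u | u) <;> simp only [Sum.elim_inl, Sum.elim_inr]
      · have := hX.nonneg u; have := hY.nonneg v'; have := hY.le v'; omega
      · have := hY.le u.1; omega
    · rintro (u | u) <;> simp only [Sum.elim_inl, Sum.elim_inr]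
      · have := hX.le u; omega
      · have := hY.nonneg u.1; have := hX.nonneg v; have := hX.le v; omega
    · intro t h0 h1
      by_cases ht : t < m
      · obtain ⟨w, hw⟩ := hY.surj (m - t) (by omega) (by omega)
        exact ⟨.inr ⟨w, (zY w).not.2 (by omega)⟩, by simp only [Sum.elim_inr]; omega⟩
      · obtain ⟨w, hw⟩ := hX.surj (t - m) (by omega) (by omega)
        exact ⟨.inl w, by simp only [Sum.elim_inl]; omega⟩
    · rintro (u | u) (w | w) h <;> simp only [Sum.elim_inl, Sum.elim_inr, concatI]
      · have hne : u ≠ w := fun hc => h (by rw [hc])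
        have := hX.adj u w hne
        split_ifs <;> omega
      · have h1 := hX.nonneg u
        have h2 := pY w
        have h3 := hi' w.1
        have h4 := hY.adj v' w.1 (Ne.symm w.2)
        rw [zX]
        split_ifs <;> omega
      · have h1 := hX.nonneg w
        have h2 := pY u
        have h4 := hY.adj u.1 v' u.2
        rw [zX]
        split_ifs <;> omega
      · have hne : u.1 ≠ w.1 := fun hc => h (by rw [Subtype.ext hc])
        rw [hY.adj u.1 w.1 hne]
        omega
  · exact fun u => by simp
  · intro w
    by_cases hw : w = v'
    · subst hw
      simp [hv, hv']
    · simp [hw]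
  · rintro (u | u)
    · exact .inl ⟨u, rfl⟩
    · exact .inr ⟨u.1, dif_pos u.2⟩
  · exact fun u => rfl
  · intro w
    by_cases hw : w = v'
    · subst hw
      simp [concatI, hcol]
    · simp [hw, concatI]
  · intro u u' h
    simp only [concatI]
    rw [if_neg]
    rw [zX]
    omega
  · intro w w' h
    have hw : w ≠ v' := (zY w).not.2 (by omega)
    by_cases hw' : w' = v'
    · subst hw'
      simp [concatI, hw]
    · simp [concatI, hw, hw']
  · intro _ u u' w w' hu hu' hw hw'
    obtain rfl := (zX u).2 hu
    obtain rfl := (zY w).2 hw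
    have hne : u' ≠ u := (zX u').not.2 (by omega)
    have hne' : w' ≠ w := (zY w').not.2 (by omega)
    have h1 := hi' w' hw'
    have h2 := (hX.adj u u' hne.symm).2 (by omega)
    simp [concatI, hne, hne']
    rw [if_neg (by omega)]
    omega

end Sturm

namespace Sturm

variable {V α : Type}

/-! ## Steps between pairs of paths -/

/-- Both sides of `S` are paths from their common end vertex to the other one, of lengths
`len`, numbered by `r`, with indices `fr` at the end vertices. -/
structure SysPos (S : Sys V α) (len : Bool → ℤ) (r : ∀ x, (Fside S x).gr.Vert → ℤ)
    (fr : ℕ × ℕ × ℕ) : Prop where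
  len_pos : ∀ x, 1 ≤ len x
  path : ∀ x, IsPath (Fside S x).gr (len x) (r x)
  r_c : ∀ x, r x (Fside S x).c = 0
  r_o : ∀ x, r x (Fside S x).o = len x
  col_c : S.FA.gr.col S.FA.c = S.FB.gr.col S.FB.c
  idx_c : ∀ x u, r x u = 1 → (Fside S x).gr.idx (Fside S x).c u = fr.2.2
  idx_o : ∀ x u, r x u = len x - 1 →
    (Fside S x).gr.idx (Fside S x).o u = if x = true then fr.1 else fr.2.1

/-- One stage of an `IsTower`. -/
structure StepSpec {S : Sys V α} (st : StepRes S) (s : Bool) (e : ℤ) (len : Bool → ℤ)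
    (r : ∀ x, (Fside S x).gr.Vert → ℤ) (len' : Bool → ℤ)
    (r' : ∀ x, (Fside st.next x).gr.Vert → ℤ) : Prop where
  e_eq : e = 0 ∨ e = 1
  len_s : len' s = len s + len (!s) + e
  len_ns : len' (!s) = len (!s)
  r_s : ∀ v, r' s (st.sel s s v) = len (!s) + e + r s v
  r_ns : ∀ y v, r' y (st.sel (!s) y v) = len (!s) - r (!s) v
  col_sel : ∀ x y, y = s ∨ y = x → ∀ v,
    (Fside st.next y).gr.col (st.sel x y v) = (Fside S x).gr.col v
  surj : ∀ y u, ∃ x v, (y = s ∨ y = x) ∧ st.sel x y v = u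
  idx_sel : ∀ x y, y = s ∨ y = x → ∀ u v, (y ≠ s ∨ r x u ≠ 0 ∨ (e = 1 ∧ r x v ≠ 0)) →
    (Fside st.next y).gr.idx (st.sel x y u) (st.sel x y v) = (Fside S x).gr.idx u v
  glue : e = 0 → ∀ u u' w w', r s u = 0 → r s u' = 1 → r (!s) w = 0 → r (!s) w' = 1 →
    (Fside st.next s).gr.idx (st.sel s s u) (st.sel s s u') +
      (Fside st.next s).gr.idx (st.sel (!s) s w) (st.sel (!s) s w') =
      (Fside S (!s)).gr.idx w w'

/-- The step extending the `A`-side to a concatenation `Z` of both sides. -/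
def stepA (S : Sys V α) (Z : EIG V α) (iX : S.FA.gr.Vert → Z.Vert)
    (iY : S.FB.gr.Vert → Z.Vert) : StepRes S where
  next := ⟨⟨Z, iY S.FB.o, iX S.FA.o⟩, ⟨S.FB.gr, S.FB.o, S.FB.c⟩⟩
  embA := iX
  embB := id
  crossAB := fun _ => S.FB.o
  crossBA := iY

/-- The step extending the `B`-side to a concatenation `Z` of both sides. -/
def stepB (S : Sys V α) (Z : EIG V α) (iX : S.FA.gr.Vert → Z.Vert)
    (iY : S.FB.gr.Vert → Z.Vert) : StepRes S where
  next := ⟨⟨S.FA.gr, S.FA.o, S.FA.c⟩, ⟨Z, iX S.FA.o, iY S.FB.o⟩⟩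
  embA := id
  embB := iY
  crossAB := iX
  crossBA := fun _ => S.FA.o

section Steps

variable {S : Sys V α} {len : Bool → ℤ} {r : ∀ x, (Fside S x).gr.Vert → ℤ} {fr : ℕ × ℕ × ℕ}
  {Z : EIG V α} {iX : S.FA.gr.Vert → Z.Vert} {iY : S.FB.gr.Vert → Z.Vert}
  {rZ : Z.Vert → ℤ} {e : ℤ}

theorem SysPos.exists_stepA (h : SysPos S len r fr)
    (hc : IsPathConcat S.FA.gr S.FB.gr Z iX iY (r true) (r false) rZ (len true) (len false) e) :
    ∃ len' r', StepSpec (stepA S Z iX iY) true e len r len' r' ∧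
      SysPos (stepA S Z iX iY).next len' r' (fr.1, fr.2.2, fr.2.1) := by
  have he := hc.e_eq
  have hlA := h.len_pos true
  have hlB := h.len_pos false
  have hcB : r false S.FB.c = 0 := h.r_c false
  have hoA : r true S.FA.o = len true := h.r_o true
  have hoB : r false S.FB.o = len false := h.r_o false
  refine ⟨fun x => if x = true then len true + len false + e else len false,
    fun | true => rZ | false => fun u => len false - r false u, ?_, ?_⟩
  · constructor
    · exact he
    · rfl
    · rfl
    · exact hc.rZ_left
    · rintro (_ | _) v
      · rfl
      · exact hc.rZ_right v
    · rintro (_ | _) (_ | _) hxy v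
      · rfl
      · exact hc.col_right v
      · simp at hxy
      · exact hc.col_left v
    · rintro (_ | _) u
      · exact ⟨false, u, .inr rfl, rfl⟩
      · rcases hc.surj u with ⟨v, hv⟩ | ⟨v, hv⟩
        · exact ⟨true, v, .inl rfl, hv⟩
        · exact ⟨false, v, .inl rfl, hv⟩
    · rintro (_ | _) (_ | _) hxy u v huv
      · rfl
      · exact hc.idx_right u v (by simpa using huv)
      · simp at hxy
      · exact hc.idx_left u v (by simpa using huv)
    · exact hc.glue
  · constructor
    · rintro (_ | _) <;> simp <;> omega
    · rintro (_ | _)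
      · exact (h.path false).reverse
      · exact hc.path
    · rintro (_ | _)
      · exact sub_eq_zero.2 hoB.symm
      · exact (hc.rZ_right _).trans (sub_eq_zero.2 hoB.symm)
    · rintro (_ | _)
      · change len false - r false S.FB.c = len false
        omega
      · change rZ (iX S.FA.o) = len true + len false + e
        rw [hc.rZ_left]
        omega
    · exact hc.col_right _
    · rintro (_ | _) u hu
      · replace hu : len false - r false u = 1 := hu
        exact h.idx_o false u (by omega)
      · replace hu : rZ u = 1 := hu
        obtain ⟨w, hw⟩ := (h.path false).surj (len false - 1) (by omega) (by omega)
        obtain rfl : iY w = u := hc.path.inj _ _ ((hc.rZ_right w).trans (by omega))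
        exact (hc.idx_right _ _ (.inl (by omega))).trans (h.idx_o false w hw)
    · rintro (_ | _) u hu
      · replace hu : len false - r false u = len false - 1 := hu
        exact h.idx_c false u (by omega)
      · replace hu : rZ u = len true + len false + e - 1 := hu
        obtain ⟨w, hw⟩ := (h.path true).surj (len true - 1) (by omega) (by omega)
        obtain rfl : iX w = u := hc.path.inj _ _ ((hc.rZ_left w).trans (by omega))
        exact (hc.idx_left _ _ (.inl (by omega))).trans (h.idx_o true w hw)

theorem SysPos.exists_stepB (h : SysPos S len r fr)
    (hc : IsPathConcat S.FA.gr S.FB.gr Z iX iY (r true) (r false) rZ (len true) (len false) e) :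
    ∃ len' r', StepSpec (stepB S Z iX iY) false e len r len' r' ∧
      SysPos (stepB S Z iX iY).next len' r' (fr.2.2, fr.2.1, fr.1) := by
  have he := hc.e_eq
  have hlA := h.len_pos true
  have hlB := h.len_pos false
  have hcA : r true S.FA.c = 0 := h.r_c true
  have hcB : r false S.FB.c = 0 := h.r_c false
  have hoA : r true S.FA.o = len true := h.r_o true
  have hoB : r false S.FB.o = len false := h.r_o false
  refine ⟨fun x => if x = true then len true else len true + len false + e,
    fun | true => fun u => len true - r true u
        | false => fun z => len true + len false + e - rZ z, ?_, ?_⟩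
  · constructor
    · exact he
    · simp only [Bool.not_false, Bool.false_eq_true, if_false]; ring
    · rfl
    · intro v
      change len true + len false + e - rZ (iY v) = len true + e + r false v
      have := hc.rZ_right v
      omega
    · rintro (_ | _) v
      · change len true + len false + e - rZ (iX v) = len true - r true v
        have := hc.rZ_left v
        omega
      · rfl
    · rintro (_ | _) (_ | _) hxy v
      · exact hc.col_right v
      · simp at hxy
      · exact hc.col_left v
      · rfl
    · rintro (_ | _) u
      · rcases hc.surj u with ⟨v, hv⟩ | ⟨v, hv⟩
        · exact ⟨true, v, .inl rfl, hv⟩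
        · exact ⟨false, v, .inl rfl, hv⟩
      · exact ⟨true, u, .inr rfl, rfl⟩
    · rintro (_ | _) (_ | _) hxy u v huv
      · exact hc.idx_right u v (by simpa using huv)
      · simp at hxy
      · exact hc.idx_left u v (by simpa using huv)
      · rfl
    · intro he0 u u' w w' hu hu' hw hw'
      obtain rfl : u = S.FB.c := (h.path false).inj _ _ (hu.trans hcB.symm)
      obtain rfl : w = S.FA.c := (h.path true).inj _ _ (hw.trans hcA.symm)
      rw [add_comm]
      exact (hc.glue he0 _ _ _ _ hw hw' hu hu').trans
        ((h.idx_c false u' hu').trans (h.idx_c true w' hw').symm)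
  · constructor
    · rintro (_ | _) <;> simp <;> omega
    · rintro (_ | _)
      · exact hc.path.reverse
      · exact (h.path true).reverse
    · rintro (_ | _)
      · change len true + len false + e - rZ (iX S.FA.o) = 0
        rw [hc.rZ_left]
        omega
      · exact sub_eq_zero.2 hoA.symm
    · rintro (_ | _)
      · change len true + len false + e - rZ (iY S.FB.o) = len true + len false + e
        rw [hc.rZ_right]
        omega
      · change len true - r true S.FA.c = len true
        omega
    · exact (hc.col_left _).symm
    · rintro (_ | _) u hu
      · replace hu : len true + len false + e - rZ u = 1 := hu
        obtain ⟨w, hw⟩ := (h.path true).surj (len true - 1) (by omega) (by omega)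
        obtain rfl : iX w = u := hc.path.inj _ _ ((hc.rZ_left w).trans (by omega))
        exact (hc.idx_left _ _ (.inl (by omega))).trans (h.idx_o true w hw)
      · replace hu : len true - r true u = 1 := hu
        exact h.idx_o true u (by omega)
    · rintro (_ | _) u hu
      · replace hu : len true + len false + e - rZ u = len true + len false + e - 1 := hu
        obtain ⟨w, hw⟩ := (h.path false).surj (len false - 1) (by omega) (by omega)
        obtain rfl : iY w = u := hc.path.inj _ _ ((hc.rZ_right w).trans (by omega))
        exact (hc.idx_right _ _ (.inl (by omega))).trans (h.idx_o false w hw)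
      · replace hu : len true - r true u = len true - 1 := hu
        exact h.idx_c true u (by omega)

end Steps

/-- The update of the indices at the end vertices, in a step extending the `s`-side. -/
def frakStep (s : Bool) (p : ℕ × ℕ × ℕ) : ℕ × ℕ × ℕ :=
  if s = true then (p.1, p.2.2, p.2.1) else (p.2.2, p.2.1, p.1)

theorem GtK.not_ltK {αs : ℕ → Bool} {k : ℕ} (h : GtK αs k) : ¬ LtK αs k := by
  obtain ⟨j, hj, hj'⟩ := h
  intro h
  simp [h j hj.le] at hj'

theorem GtK.not_isK {αs : ℕ → Bool} {k : ℕ} (h : GtK αs k) : ¬ IsK αs k := by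
  obtain ⟨j, hj, hj'⟩ := h
  intro h
  simp [h.2 j hj] at hj'

theorem IsK.not_ltK {αs : ℕ → Bool} {k : ℕ} (h : IsK αs k) : ¬ LtK αs k := by
  intro h'
  simp [IsK, h' k le_rfl] at h

theorem frak_succ {αs : ℕ → Bool} {idat : ℕ → IdxData} {k : ℕ} (h : GtK αs (k + 1)) :
    frak αs idat (k + 1) = frakStep (αs (k + 1)) (frak αs idat k) := by
  change (if IsK αs (k + 1) then _ else if GtK αs (k + 1) then _ else _) = _
  rw [if_neg h.not_isK, if_pos h]
  rfl

theorem frak_isK {αs : ℕ → Bool} {idat : ℕ → IdxData} {k : ℕ} (h : IsK αs k) :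
    frak αs idat k = frakBase idat k := by
  cases k with
  | zero => exact if_pos h.1
  | succ k => exact if_pos h

theorem SysPos.exists_step {S : Sys V α} {len : Bool → ℤ} {r : ∀ x, (Fside S x).gr.Vert → ℤ}
    {d : ℕ} {αs : ℕ → Bool} {idat : ℕ → IdxData} (hadm : AdmissibleIdx d αs idat) {k : ℕ}
    (hk : GtK αs (k + 1)) (h : SysPos S len r (frak αs idat k)) :
    ∃ e len' r', StepSpec (Fstep αs idat (k + 1) S) (αs (k + 1)) e len r len' r' ∧
      SysPos (Fstep αs idat (k + 1) S).next len' r' (frak αs idat (k + 1)) := by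
  rw [frak_succ hk]
  have hadm' := (hadm (k + 1)).2.2 hk
  rw [frakC, Nat.add_sub_cancel] at hadm'
  rcases hadm' with ⟨i, hi, hi1, hi2⟩ | ⟨i, j, hij, hi1, -, hj1, -⟩
  · have hc := isPathConcat_concatI (h.path true) (h.path false) (h.r_c true) (h.r_c false)
      h.col_c hi1 (fun w hw => by
        have := h.idx_c false w hw
        exact this ▸ hi2)
    cases hs : αs (k + 1) with
    | false =>
      rw [show Fstep αs idat (k + 1) S = stepB S (concatI S.FA.gr S.FB.gr S.FA.c S.FB.c i) Sum.inl
        (fun w => if h : w ≠ S.FB.c then Sum.inr ⟨w, h⟩ else Sum.inl S.FA.c) by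
        simp only [Fstep, if_neg hk.not_ltK, if_neg hk.not_isK, hs, hi]
        rfl]
      exact ⟨0, h.exists_stepB hc⟩
    | true =>
      rw [show Fstep αs idat (k + 1) S = stepA S (concatI S.FA.gr S.FB.gr S.FA.c S.FB.c i) Sum.inl
        (fun w => if h : w ≠ S.FB.c then Sum.inr ⟨w, h⟩ else Sum.inl S.FA.c) by
        simp only [Fstep, if_neg hk.not_ltK, if_neg hk.not_isK, hs, hi]
        rfl]
      exact ⟨0, h.exists_stepA hc⟩
  · have hc := isPathConcat_concatIJ (h.path true) (h.path false) (h.r_c true) (h.r_c false)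
      hi1 hj1
    cases hs : αs (k + 1) with
    | false =>
      rw [show Fstep αs idat (k + 1) S = stepB S (concatIJ S.FA.gr S.FB.gr S.FA.c S.FB.c i j) Sum.inl
        Sum.inr by
        simp only [Fstep, if_neg hk.not_ltK, if_neg hk.not_isK, hs, hij]
        rfl]
      exact ⟨1, h.exists_stepB hc⟩
    | true =>
      rw [show Fstep αs idat (k + 1) S = stepA S (concatIJ S.FA.gr S.FB.gr S.FA.c S.FB.c i j) Sum.inl
        Sum.inr by
        simp only [Fstep, if_neg hk.not_ltK, if_neg hk.not_isK, hs, hij]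
        rfl]
      exact ⟨1, h.exists_stepA hc⟩

/-- Dependent choice. -/
theorem exists_dependent_seq {P : ℕ → Type*} (R : ∀ n, P n → P (n + 1) → Prop) (p : P 0)
    (h : ∀ n q, ∃ q', R n q q') : ∃ f : ∀ n, P n, f 0 = p ∧ ∀ n, R n (f n) (f (n + 1)) := by
  choose g hg using h
  exact ⟨fun n => Nat.rec p g n, rfl, fun n => hg n _⟩

/-- From `K` on, the graphs `F^A_k, F^B_k` form a tower of paths. -/
theorem exists_isTower {a b : α} {d : ℕ} {αs : ℕ → Bool} {idat : ℕ → IdxData}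
    (hadm : AdmissibleIdx d αs idat) {K : ℕ} (hK : αs K = true) {len₀ : Bool → ℤ}
    {r₀ : ∀ x, (Fside (Fsys V α a b d αs idat K) x).gr.Vert → ℤ}
    (h₀ : SysPos (Fsys V α a b d αs idat K) len₀ r₀ (frak αs idat K)) :
    ∃ (e : ℕ → ℤ) (len : ℕ → Bool → ℤ)
      (r : ∀ n x, (Fside (Fsys V α a b d αs idat (K + n)) x).gr.Vert → ℤ),
      len 0 = len₀ ∧ r 0 = r₀ ∧
      IsTower (fun n x => (Fside (Fsys V α a b d αs idat (K + n)) x).gr)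
        (fun n x y => (Fstep αs idat (K + n + 1) (Fsys V α a b d αs idat (K + n))).sel x y)
        (fun n => αs (K + n + 1)) e len r := by
  obtain ⟨f, hf0, hf⟩ := exists_dependent_seq
    (P := fun n => {p : (Bool → ℤ) × (∀ x, (Fside (Fsys V α a b d αs idat (K + n)) x).gr.Vert → ℤ) //
      SysPos (Fsys V α a b d αs idat (K + n)) p.1 p.2 (frak αs idat (K + n))})
    (fun n p q => ∃ e, StepSpec (Fstep αs idat (K + n + 1) (Fsys V α a b d αs idat (K + n)))
      (αs (K + n + 1)) e p.1.1 p.1.2 q.1.1 q.1.2) ⟨(len₀, r₀), h₀⟩ (by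
      rintro n ⟨⟨len, r⟩, h⟩
      obtain ⟨e, len', r', h1, h2⟩ := h.exists_step hadm (k := K + n) ⟨K, by omega, hK⟩
      exact ⟨⟨(len', r'), h2⟩, e, h1⟩)
  choose e he using hf
  refine ⟨e, fun n => (f n).1.1, fun n => (f n).1.2, congrArg (·.1.1) hf0,
    congrArg (·.1.2) hf0, ?_⟩
  exact
    { e_eq := fun n => (he n).e_eq
      len_pos := fun n => (f n).2.len_pos
      len_s := fun n => (he n).len_s
      len_ns := fun n => (he n).len_ns
      path := fun n => (f n).2.path
      r_s := fun n => (he n).r_s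
      r_ns := fun n => (he n).r_ns
      col_sel := fun n => (he n).col_sel
      surj := fun n => (he n).surj
      idx_sel := fun n => (he n).idx_sel
      glue := fun n => (he n).glue }

end Sturm

namespace Sturm

variable {V α : Type}

/-! ## The initial steps -/

/-- `S` consists of a vertex colored `a` and of a path of length `m`, numbered by `rY`, on which
exactly the vertex numbered `m` is colored `b`, with indices `ii` and `jj` at its end vertices. -/
structure PreSpec (a b : α) (S : Sys V α) (m : ℕ) (rY : S.FB.gr.Vert → ℤ) (ii jj : ℕ) :
    Prop where
  eq_c : ∀ u, u = S.FA.c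
  col_c : S.FA.gr.col S.FA.c = a
  path : IsPath S.FB.gr m rY
  r_c : rY S.FB.c = 0
  r_o : rY S.FB.o = m
  col : ∀ w, S.FB.gr.col w = b ↔ rY w = m
  idx_o : ∀ u, rY u = m - 1 → S.FB.gr.idx S.FB.o u = jj
  idx_c : ∀ u, rY u = 1 → S.FB.gr.idx S.FB.c u = ii

section PreSpec

variable {a b : α} {S : Sys V α} {m : ℕ} {rY : S.FB.gr.Vert → ℤ} {ii jj i j : ℕ}

theorem PreSpec.isPathConcat (h : PreSpec a b S m rY ii jj) (hi : 1 ≤ i) (hj : 1 ≤ j) :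
    IsPathConcat S.FA.gr S.FB.gr (concatIJ S.FA.gr S.FB.gr S.FA.c S.FB.c i j) Sum.inl Sum.inr
      (fun _ => 0) rY (Sum.elim (fun _ => (m : ℤ) + 1 + 0) (fun w => m - rY w)) 0 m 1 := by
  have hX : IsPath S.FA.gr 0 (fun _ => 0) :=
    { inj := fun u v _ => (h.eq_c u).trans (h.eq_c v).symm
      nonneg := fun _ => le_rfl
      le := fun _ => le_rfl
      surj := fun t h0 h1 => ⟨S.FA.c, by omega⟩
      adj := fun u v huv => (huv ((h.eq_c u).trans (h.eq_c v).symm)).elim }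
  exact isPathConcat_concatIJ hX h.path rfl h.r_c hi hj

theorem PreSpec.concat (hab : a ≠ b) (h : PreSpec a b S m rY ii jj) (hi : 1 ≤ i) (hj : 1 ≤ j)
    (hjj : m = 0 → j = jj) :
    ∃ rZ : S.FA.gr.Vert ⊕ S.FB.gr.Vert → ℤ,
      (∀ u, rZ (Sum.inl u) = m + 1) ∧ (∀ w, rZ (Sum.inr w) = m - rY w) ∧
      IsPath (concatIJ S.FA.gr S.FB.gr S.FA.c S.FB.c i j) (m + 1) rZ ∧
      (∀ u, (concatIJ S.FA.gr S.FB.gr S.FA.c S.FB.c i j).col u = b ↔ rZ u = 0) ∧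
      (∀ u, rZ u = 1 → (concatIJ S.FA.gr S.FB.gr S.FA.c S.FB.c i j).idx (Sum.inr S.FB.o) u = jj) ∧
      (∀ v u, rZ u = m → (concatIJ S.FA.gr S.FB.gr S.FA.c S.FB.c i j).idx (Sum.inl v) u = i) := by
  have hc := h.isPathConcat hi hj
  refine ⟨Sum.elim (fun _ => (m : ℤ) + 1 + 0) (fun w => m - rY w), fun u => by simp,
    fun w => rfl, by simpa using hc.path, ?_, ?_, ?_⟩
  · rintro (u | w)
    · refine ⟨fun hu => (hab ?_).elim, fun hu => ?_⟩
      · rw [← h.col_c, ← h.eq_c u]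
        exact hu
      · simp only [Sum.elim_inl] at hu
        omega
    · simp only [Sum.elim_inr]
      refine (h.col w).trans ?_
      omega
  · rintro (u | w) hu <;> simp only [Sum.elim_inl, Sum.elim_inr] at hu
    · have hm : m = 0 := by omega
      have : S.FB.o = S.FB.c := h.path.inj _ _ (by rw [h.r_c, h.r_o, hm]; rfl)
      simp [concatIJ, this, ← h.eq_c u, hjj hm]
    · have := h.path.nonneg w
      rw [hc.idx_right _ _ (.inl (by rw [h.r_o]; omega))]
      exact h.idx_o w (by omega)
  · rintro v (u | w) hu <;> simp only [Sum.elim_inl, Sum.elim_inr] at hu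
    · omega
    · have : w = S.FB.c := h.path.inj _ _ (by rw [h.r_c]; omega)
      simp [concatIJ, this, ← h.eq_c v]

end PreSpec

/-- The systems `(F^A_{k-1}, F^B_{k-1})`. -/
def prevSys (V : Type) {α : Type} (a b : α) (d : ℕ) (αs : ℕ → Bool) (idat : ℕ → IdxData) :
    ℕ → Sys V α
  | 0 => baseSys V a b d
  | k + 1 => Fsys V α a b d αs idat k

section Initial

variable {a b : α} {d : ℕ} {αs : ℕ → Bool} {idat : ℕ → IdxData}

theorem Fsys_eq_next_prevSys (k : ℕ) :
    Fsys V α a b d αs idat k = (Fstep αs idat k (prevSys V a b d αs idat k)).next := by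
  cases k <;> rfl

theorem exists_preSpec (hab : a ≠ b) (hadm : AdmissibleIdx d αs idat) (k : ℕ)
    (hk : ∀ j < k, αs j = false) :
    ∃ rY, PreSpec a b (prevSys V a b d αs idat k) k rY (idat (k - 1)).iOf (idat 0).jOf := by
  induction k with
  | zero =>
    refine ⟨fun _ => 0, fun _ => rfl, rfl, ?_, rfl, rfl, ?_, ?_, ?_⟩
    · exact ⟨fun _ _ _ => rfl, fun _ => le_rfl, fun _ => le_rfl,
        fun t h0 h1 => ⟨PUnit.unit, by simp at h1; omega⟩, fun u v huv => (huv rfl).elim⟩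
    · exact fun _ => ⟨fun _ => rfl, fun _ => rfl⟩
    · intro u hu
      simp at hu
    · intro u hu
      simp at hu
  | succ k ih =>
    obtain ⟨rY, h⟩ := ih fun j hj => hk j (by omega)
    have hlt : LtK αs k := fun j hj => hk j (by omega)
    obtain ⟨i, j, hij, hi, -, hj, -⟩ := (hadm k).1 hlt
    obtain ⟨rZ, rl, rr, hp, hcol, ho, hc⟩ := h.concat hab hi hj
      (by rintro rfl; simp [hij, IdxData.jOf])
    have hS : prevSys V a b d αs idat (k + 1) =
        { FA := (prevSys V a b d αs idat k).FA
          FB := ⟨concatIJ (prevSys V a b d αs idat k).FA.gr (prevSys V a b d αs idat k).FB.gr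
            (prevSys V a b d αs idat k).FA.c (prevSys V a b d αs idat k).FB.c i j,
            Sum.inl (prevSys V a b d αs idat k).FA.c,
            Sum.inr (prevSys V a b d αs idat k).FB.o⟩ } := by
      change Fsys V α a b d αs idat k = _
      rw [Fsys_eq_next_prevSys]
      simp only [Fstep, if_pos hlt, hij]
    rw [hS]
    refine ⟨fun u => (k + 1) - rZ u, h.eq_c, h.col_c, ?_, ?_, ?_, ?_, ?_, ?_⟩
    · exact_mod_cast hp.reverse
    · exact sub_eq_zero.2 (rl _).symm
    · have := rr (prevSys V a b d αs idat k).FB.o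
      rw [h.r_o] at this
      simp [this]
    · intro w
      refine (hcol w).trans ?_
      push_cast
      omega
    · intro u hu
      push_cast at hu
      exact ho u (by omega)
    · intro u hu
      rw [Nat.add_sub_cancel, hij]
      exact hc _ u (by omega)

theorem SysPos.inwardWeight {S : Sys V α} {len : Bool → ℤ}
    {r : ∀ x, (Fside S x).gr.Vert → ℤ} {fr : ℕ × ℕ × ℕ} (h : SysPos S len r fr) {x : Bool}
    {L : ℤ} (hL : len x = L) (y : Bool) :
    InwardWeight (Fside S y).gr.idx (fun v => sgnLabel y (r y v)) (sgnLabel x L)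
      (if x = true then fr.1 else fr.2.1) := by
  have hpos := h.len_pos x
  have habs : ∀ (x : Bool) {t : ℤ}, 0 ≤ t → |sgnLabel x t| = t := by
    intro x t ht
    cases x <;> simp [sgnLabel, abs_of_nonneg ht]
  intro v hv
  have h0 := (h.path y).nonneg v
  have hxy : y = x ∧ r y v = L := by
    simp only [sgnLabel] at hv
    cases x <;> cases y <;> simp at hv ⊢ <;> omega
  obtain ⟨rfl, hv'⟩ := hxy
  obtain rfl : v = (Fside S y).o := (h.path y).inj _ _ (by rw [h.r_o, hv', hL])
  rw [habs y (by omega : 0 ≤ L)]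
  intro z _ _ hz
  rw [habs y ((h.path y).nonneg z)] at hz
  refine ⟨.inl (h.idx_o y z (by omega)), fun z' hz' _ _ hz'' => (hz' ?_).elim⟩
  rw [habs y ((h.path y).nonneg z')] at hz''
  exact (h.path y).inj _ _ (hz''.trans hz.symm)

/-- The position at stage `K`. -/
theorem exists_sysPos (hab : a ≠ b) (hadm : AdmissibleIdx d αs idat) {K : ℕ} (hK : IsK αs K) :
    ∃ (len : Bool → ℤ) (r : ∀ x, (Fside (Fsys V α a b d αs idat K) x).gr.Vert → ℤ),
      SysPos (Fsys V α a b d αs idat K) len r (frak αs idat K) ∧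
      (∀ x v, (Fside (Fsys V α a b d αs idat K) x).gr.col v = b ↔ r x v = 0) ∧
      (len true ≤ len false → len true = len false ∧
        (frak αs idat K).1 ≠ (frak αs idat K).2.1) := by
  have hpre := exists_preSpec (V := V) hab hadm K hK.2
  rw [frak_isK hK, Fsys_eq_next_prevSys]
  generalize prevSys V a b d αs idat K = S at hpre
  obtain ⟨rY, h⟩ := hpre
  rcases (hadm K).2.1 hK with ⟨i, i', j, hij, hi, hi', -, hj, -⟩ | ⟨hK0, i, j, hij, hi, -, hj, -⟩
  · rw [show Fstep αs idat K S = _ by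
      simp only [Fstep, if_neg hK.not_ltK, if_pos hK, hij]
      rfl]
    have hjj : K = 0 → j = (idat 0).jOf := by rintro rfl; simp [hij, IdxData.jOf]
    obtain ⟨rZ, rl, rr, hp, hcol, ho, hc⟩ := h.concat hab hi hj hjj
    obtain ⟨rZ', rl', rr', hp', hcol', ho', hc'⟩ := h.concat hab (hi.trans hi'.le) hj hjj
    refine ⟨fun _ => K + 1, fun | true => rZ | false => rZ', ?_, ?_, ?_⟩
    · constructor
      · intro x; simp
      · rintro (_ | _)
        exacts [hp', hp]
      · rintro (_ | _)
        · exact (rr' _).trans (sub_eq_zero.2 h.r_o.symm)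
        · exact (rr _).trans (sub_eq_zero.2 h.r_o.symm)
      · rintro (_ | _)
        · exact rl' _
        · exact rl _
      · rfl
      · simp only [frakBase, hij]
        rintro (_ | _)
        exacts [ho', ho]
      · simp only [frakBase, hij, add_sub_cancel_right]
        rintro (_ | _)
        exacts [hc' _, hc _]
    · rintro (_ | _)
      exacts [hcol', hcol]
    · simp only [frakBase, hij]
      exact fun _ => ⟨trivial, by omega⟩
  · rw [show Fstep αs idat K S = _ by
      simp only [Fstep, if_neg hK.not_ltK, if_pos hK, hij]
      rfl]
    obtain ⟨rZ, rl, rr, hp, hcol, ho, hc⟩ := h.concat hab hi hj (fun hK' => (hK0 hK').elim)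
    refine ⟨fun x => if x = true then K + 1 else K, fun | true => rZ | false => fun w => K - rY w,
      ?_, ?_, ?_⟩
    · constructor
      · rintro (_ | _) <;> simp; omega
      · rintro (_ | _)
        exacts [h.path.reverse, hp]
      · rintro (_ | _)
        · exact sub_eq_zero.2 h.r_o.symm
        · exact (rr _).trans (sub_eq_zero.2 h.r_o.symm)
      · rintro (_ | _)
        · exact (congrArg (fun t => (K : ℤ) - t) h.r_c).trans (sub_zero _)
        · exact rl _
      · rfl
      · simp only [frakBase, hij]
        rintro (_ | _) u hu
        · replace hu : (K : ℤ) - rY u = 1 := hu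
          exact h.idx_o u (by omega)
        · exact ho u hu
      · simp only [frakBase, hij, if_neg hK0]
        rintro (_ | _) u hu
        · replace hu : (K : ℤ) - rY u = K - 1 := hu
          exact h.idx_c u (by omega)
        · replace hu : rZ u = K + 1 - 1 := hu
          exact hc _ u (by omega)
    · rintro (_ | _) v
      · refine (h.col v).trans ?_
        change _ ↔ (K : ℤ) - rY v = 0
        omega
      · exact hcol v
    · simp

/-- Up to stage `K`, the natural inclusions are injective and preserve colors. -/
theorem sel_of_not_gtK (hadm : AdmissibleIdx d αs idat) {k : ℕ} (hk : ¬ GtK αs k) (S : Sys V α)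
    {x y : Bool} (hxy : y = αs k ∨ y = x) :
    Function.Injective ((Fstep αs idat k S).sel x y) ∧
      ∀ v, (Fside (Fstep αs idat k S).next y).gr.col ((Fstep αs idat k S).sel x y v) =
        (Fside S x).gr.col v := by
  have hk' : ∀ j < k, αs j = false := by
    intro j hj
    by_contra h
    exact hk ⟨j, hj, by simpa using h⟩
  cases hs : αs k with
  | false =>
    have hlt : LtK αs k := fun j hj => (Nat.lt_or_eq_of_le hj).elim (hk' j) (fun h => h ▸ hs)
    obtain ⟨i, j, hij, -⟩ := (hadm k).1 hlt
    rw [hs] at hxy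
    rw [show Fstep αs idat k S = _ by
      simp only [Fstep, if_pos hlt, hij]
      rfl]
    cases x <;> cases y
    · exact ⟨Sum.inr_injective, fun _ => rfl⟩
    · simp at hxy
    · exact ⟨Sum.inl_injective, fun _ => rfl⟩
    · exact ⟨Function.injective_id, fun _ => rfl⟩
  | true =>
    have hK : IsK αs k := ⟨hs, hk'⟩
    rw [hs] at hxy
    rcases (hadm k).2.1 hK with ⟨i, i', j, hij, -⟩ | ⟨-, i, j, hij, -⟩
    · rw [show Fstep αs idat k S = _ by
        simp only [Fstep, if_neg hK.not_ltK, if_pos hK, hij]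
        rfl]
      cases x <;> cases y
      · exact ⟨Sum.inr_injective, fun _ => rfl⟩
      · exact ⟨Sum.inr_injective, fun _ => rfl⟩
      · exact ⟨Sum.inl_injective, fun _ => rfl⟩
      · exact ⟨Sum.inl_injective, fun _ => rfl⟩
    · rw [show Fstep αs idat k S = _ by
        simp only [Fstep, if_neg hK.not_ltK, if_pos hK, hij]
        rfl]
      cases x <;> cases y
      · exact ⟨Function.injective_id, fun _ => rfl⟩
      · exact ⟨Sum.inr_injective, fun _ => rfl⟩
      · simp at hxy
      · exact ⟨Sum.inl_injective, fun _ => rfl⟩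

end Initial

end Sturm

namespace Sturm

variable {V α : Type}

/-! ## Direct limits along admissible sequences -/

theorem IsDirLimit.shift {F : ℕ → EIG V α} {ι : ∀ k, (F k).Vert → (F (k + 1)).Vert}
    {Y : EIG V α} (h : IsDirLimit F ι Y) (K : ℕ) :
    IsDirLimit (fun m => F (K + m)) (fun m => ι (K + m)) Y := by
  obtain ⟨j, hι, hinj, hsurj, hcol, hidx⟩ := h
  refine ⟨fun m => j (K + m), fun m => hι (K + m), fun m => hinj _, fun y => ?_,
    fun m => hcol _, fun y z => ?_⟩
  · obtain ⟨k, v, rfl⟩ := hsurj y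
    obtain ⟨w, hw⟩ := exists_rep_of_le hι v (Nat.le_add_left k K)
    exact ⟨k, w, hw⟩
  · obtain ⟨N, hN⟩ := hidx y z
    exact ⟨N, fun k hk => hN (K + k) (by omega)⟩

/-- The identification of equal sides. -/
def sideIso (S : Sys V α) {x y : Bool} (h : x = y) : EIGIso (Fside S x).gr (Fside S y).gr where
  e := Equiv.cast (by rw [h])
  idx_eq := by subst h; exact fun _ _ => rfl
  col_eq := by subst h; exact fun _ => rfl

theorem sideIso_sel {S : Sys V α} (st : StepRes S) {x x' y y' : Bool} (hx : x = x') (hy : y = y')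
    (v : (Fside S x).gr.Vert) :
    (sideIso st.next hy).e (st.sel x y v) = st.sel x' y' ((sideIso S hx).e v) := by
  subst hx
  subst hy
  rfl

section Limits

variable {a b : α} {d : ℕ} {αs : ℕ → Bool} {idat : ℕ → IdxData} {βs βs' : ℕ → Bool}

theorem nonempty_iso_of_eventually_eq {N : ℕ} (hN : ∀ k, N ≤ k → βs k = βs' k) {Y Y' : EIG V α}
    (hY : IsDirLimit (Fbeta V α a b d αs idat βs) (betaEmb V α a b d αs idat βs) Y)
    (hY' : IsDirLimit (Fbeta V α a b d αs idat βs') (betaEmb V α a b d αs idat βs') Y') :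
    Nonempty (EIGIso Y Y') :=
  hY.nonempty_iso hY' N (fun k hk => sideIso (Fsys V α a b d αs idat k) (hN k hk))
    fun _ _ v => sideIso_sel _ _ _ v

theorem sel_of_ltK (hadm : AdmissibleIdx d αs idat) {k : ℕ} (hk : LtK αs k) (S : Sys V α)
    {x y : Bool} (hxy : x = y) :
    (∀ u, y = true ∨ (Fstep αs idat k S).sel x y u ≠ (Fside (Fstep αs idat k S).next y).c) ∧
      ∀ u, (x = true ∨ u ≠ (Fside S x).c) → ∀ v,
        (Fside (Fstep αs idat k S).next y).gr.idx ((Fstep αs idat k S).sel x y u)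
          ((Fstep αs idat k S).sel x y v) = (Fside S x).gr.idx u v := by
  obtain ⟨i, j, hij, -⟩ := (hadm k).1 hk
  rw [show Fstep αs idat k S = _ by
    simp only [Fstep, if_pos hk, hij]
    rfl]
  subst hxy
  cases x
  · refine ⟨fun u => .inr Sum.inr_ne_inl, fun u hu v => if_neg fun hc => ?_⟩
    rcases hu with hu | hu
    exacts [absurd hu (by simp), hu hc.1]
  · exact ⟨fun _ => .inl rfl, fun _ _ _ => rfl⟩

theorem eventually_const_of_all_false (hα : ∀ k, αs k = false) (hβ : AdmissibleBeta αs βs) :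
    ∃ N, ∀ k, N ≤ k → βs k = decide (∀ n, βs n = true) := by
  by_cases h : ∀ n, βs n = true
  · exact ⟨0, fun k _ => by simp [h]⟩
  · simp only [h, decide_false]
    push Not at h
    obtain ⟨n, hn⟩ := h
    refine ⟨n, fun k hk => ?_⟩
    induction k, hk using Nat.le_induction with
    | base => simpa using hn
    | succ k hk ih => rcases hβ k with h | h <;> simp [h, ih, hα]

theorem exists_isDirLimit_of_all_false (hadm : AdmissibleIdx d αs idat) (hα : ∀ k, αs k = false)
    (hβ : AdmissibleBeta αs βs) :
    ∃ Y, IsDirLimit (Fbeta V α a b d αs idat βs) (betaEmb V α a b d αs idat βs) Y := by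
  obtain ⟨N, hN⟩ := eventually_const_of_all_false hα hβ
  have hN' : ∀ k, N ≤ k → βs k = βs (k + 1) := fun k hk => by rw [hN k hk, hN (k + 1) (by omega)]
  have hgt : ∀ k, ¬ GtK αs k := by
    rintro k ⟨j, -, hj⟩
    simp [hα] at hj
  have hlt : ∀ k, LtK αs k := fun k j _ => hα j
  exact exists_isDirLimit _ _
    (fun k => (sel_of_not_gtK hadm (hgt (k + 1)) _ (hβ k)).1)
    (fun k => (sel_of_not_gtK hadm (hgt (k + 1)) _ (hβ k)).2) N
    (fun k u => βs k = true ∨ u ≠ (Fside (Fsys V α a b d αs idat k) (βs k)).c)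
    (fun k hk u _ => (sel_of_ltK hadm (hlt (k + 1)) _ (hN' k hk)).1 u)
    (fun k hk u hu => (sel_of_ltK hadm (hlt (k + 1)) _ (hN' k hk)).2 u hu)
    (fun k hk u => .inl ((sel_of_ltK hadm (hlt (k + 1)) _ (hN' k hk)).1 u))

/-- If `K` is infinite, only the limit of the `A`-sides has no vertex colored `b`. -/
theorem exists_col_iff_of_all_false (hab : a ≠ b) (hadm : AdmissibleIdx d αs idat)
    (hα : ∀ k, αs k = false) {Y : EIG V α}
    (hY : IsDirLimit (Fbeta V α a b d αs idat βs) (betaEmb V α a b d αs idat βs) Y) :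
    (∃ y, Y.col y = b) ↔ ¬ ∀ n, βs n = true := by
  obtain ⟨j, -, -, hsurj, hcol, -⟩ := hY
  constructor
  · rintro ⟨y, hy⟩ hall
    obtain ⟨k, v, rfl⟩ := hsurj y
    rw [hcol] at hy
    obtain ⟨rY, h⟩ := exists_preSpec (V := V) hab hadm (k + 1) (fun j _ => hα j)
    have key : ∀ x, x = true → ∀ v : (Fside (Fsys V α a b d αs idat k) x).gr.Vert,
        (Fside (Fsys V α a b d αs idat k) x).gr.col v = a := by
      rintro _ rfl v
      exact (congrArg _ (h.eq_c v)).trans h.col_c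
    exact hab ((key _ (hall k) v).symm.trans hy)
  · intro hn
    push Not at hn
    obtain ⟨n, hn⟩ := hn
    obtain ⟨rY, h⟩ := exists_preSpec (V := V) hab hadm (n + 1) (fun j _ => hα j)
    have key : ∀ x, x ≠ true → ∃ v : (Fside (Fsys V α a b d αs idat n) x).gr.Vert,
        (Fside (Fsys V α a b d αs idat n) x).gr.col v = b := by
      rintro (_ | _) hx
      · exact ⟨_, (h.col _).2 h.r_o⟩
      · exact absurd rfl hx
    obtain ⟨v, hv⟩ := key _ hn
    exact ⟨j n v, (hcol n v).trans hv⟩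

theorem exists_isDirLimit_of_isTower (hadm : AdmissibleIdx d αs idat) {K : ℕ} (hK : IsK αs K)
    (hβ : AdmissibleBeta αs βs) {e : ℕ → ℤ} {len : ℕ → Bool → ℤ}
    {r : ∀ n x, (Fside (Fsys V α a b d αs idat (K + n)) x).gr.Vert → ℤ}
    (h : IsTower (fun n x => (Fside (Fsys V α a b d αs idat (K + n)) x).gr)
      (fun n x y => (Fstep αs idat (K + n + 1) (Fsys V α a b d αs idat (K + n))).sel x y)
      (fun n => αs (K + n + 1)) e len r) :
    ∃ Y, IsDirLimit (Fbeta V α a b d αs idat βs) (betaEmb V α a b d αs idat βs) Y := by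
  have hsel : ∀ k, Function.Injective (betaEmb V α a b d αs idat βs k) ∧
      ∀ v, (Fbeta V α a b d αs idat βs (k + 1)).col (betaEmb V α a b d αs idat βs k v) =
        (Fbeta V α a b d αs idat βs k).col v := by
    intro k
    rcases Nat.lt_or_ge k K with hk | hk
    · refine sel_of_not_gtK hadm ?_ _ (hβ k)
      rintro ⟨j, hj, hj'⟩
      simp [hK.2 j (by omega)] at hj'
    · obtain ⟨n, rfl⟩ := Nat.exists_eq_add_of_le hk
      exact ⟨h.sel_injective n (hβ (K + n)), h.col_sel n _ _ (hβ (K + n))⟩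
  obtain ⟨h1, h2, h3⟩ := h.exists_limit (β := fun n => βs (K + n)) (fun n => hβ (K + n))
  refine exists_isDirLimit _ _ (fun k => (hsel k).1) (fun k => (hsel k).2) K
    (fun k u => ∀ n (v : (Fbeta V α a b d αs idat βs (K + n)).Vert), K + n = k → HEq v u →
      IsTower.Interior len r n (βs (K + n)) v) ?_ ?_ ?_
  · intro k hk u hu n v hn hv
    obtain ⟨m, rfl⟩ := Nat.exists_eq_add_of_le hk
    obtain rfl : n = m + 1 := by omega
    obtain rfl := eq_of_heq hv
    exact h1 m u (hu m u rfl HEq.rfl)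
  · intro k hk u hu
    obtain ⟨m, rfl⟩ := Nat.exists_eq_add_of_le hk
    exact h2 m u (hu m u rfl HEq.rfl)
  · intro k hk u
    obtain ⟨m, rfl⟩ := Nat.exists_eq_add_of_le hk
    refine (h3 m u).imp_left fun hu n v hn hv => ?_
    obtain rfl : n = m + 1 := by omega
    obtain rfl := eq_of_heq hv
    exact hu

end Limits

end Sturm

namespace Sturm

/-- Proposition 4.5: two `α_k`-admissible sequences `β, β'` are
eventually equal if and only if the direct limits of the systems `F^{β_k}_k` and
`F^{β'_k}_k` (taken along the natural inclusions) coincide, i.e. any two such limits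
are isomorphic as colored edge-indexed graphs. -/
theorem eventually_equal_iff_same_limit {V α : Type} (a b : α) (hab : a ≠ b)
    (d : ℕ) (hd : 3 ≤ d)
    (αs : ℕ → Bool) (idat : ℕ → IdxData) (hadm : AdmissibleIdx d αs idat)
    (βs βs' : ℕ → Bool) (hβ : AdmissibleBeta αs βs) (hβ' : AdmissibleBeta αs βs') :
    (∃ N, ∀ k, N ≤ k → βs k = βs' k) ↔
      (∀ Y Y' : EIG V α,
        IsDirLimit (Fbeta V α a b d αs idat βs) (betaEmb V α a b d αs idat βs) Y →
        IsDirLimit (Fbeta V α a b d αs idat βs') (betaEmb V α a b d αs idat βs') Y' →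
        Nonempty (EIGIso Y Y')) := by
  refine ⟨fun ⟨N, hN⟩ Y Y' hY hY' => nonempty_iso_of_eventually_eq hN hY hY', fun H => ?_⟩
  by_cases hα : ∀ k, αs k = false
  · obtain ⟨Y, hY⟩ := exists_isDirLimit_of_all_false (V := V) (a := a) (b := b) hadm hα hβ
    obtain ⟨Y', hY'⟩ := exists_isDirLimit_of_all_false (V := V) (a := a) (b := b) hadm hα hβ'
    obtain ⟨f⟩ := H Y Y' hY hY'
    obtain ⟨N, hN⟩ := eventually_const_of_all_false hα hβ
    obtain ⟨N', hN'⟩ := eventually_const_of_all_false hα hβ'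
    have hiff : (∀ n, βs n = true) ↔ ∀ n, βs' n = true := by
      rw [← not_iff_not, ← exists_col_iff_of_all_false hab hadm hα hY,
        ← exists_col_iff_of_all_false hab hadm hα hY']
      constructor
      · rintro ⟨y, hy⟩
        exact ⟨f.e y, (f.col_eq y).trans hy⟩
      · rintro ⟨y, hy⟩
        exact ⟨f.e.symm y, by rw [← f.col_eq, Equiv.apply_symm_apply, hy]⟩
    refine ⟨max N N', fun k hk => ?_⟩
    rw [hN k (le_trans (le_max_left _ _) hk), hN' k (le_trans (le_max_right _ _) hk)]
    exact decide_eq_decide.2 hiff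
  · have hex : ∃ k, αs k = true := by simpa using hα
    obtain ⟨K, hK⟩ : ∃ K, IsK αs K :=
      ⟨Nat.find hex, Nat.find_spec hex, fun j hj => by simpa using Nat.find_min hex hj⟩
    obtain ⟨len₀, r₀, h₀, hcol, hlen⟩ := exists_sysPos (V := V) hab hadm hK
    obtain ⟨e, len, r, rfl, rfl, hT⟩ := exists_isTower hadm hK.1 h₀
    obtain ⟨Y, hY⟩ := exists_isDirLimit_of_isTower hadm hK hβ hT
    obtain ⟨Y', hY'⟩ := exists_isDirLimit_of_isTower hadm hK hβ' hT
    obtain ⟨f⟩ := H Y Y' hY hY'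
    obtain ⟨N, hN⟩ := hT.eventually_eq_of_iso (β := fun n => βs (K + n))
      (β' := fun n => βs' (K + n)) hcol (fun hle => by
        obtain ⟨hl, hne⟩ := hlen hle
        exact ⟨_, _, hne, h₀.inwardWeight (x := true) rfl, h₀.inwardWeight (x := false) hl.symm⟩)
      (fun n => hβ (K + n)) (fun n => hβ' (K + n)) (hY.shift K) (hY'.shift K) f
    refine ⟨K + N, fun k hk => ?_⟩
    obtain ⟨m, rfl⟩ := Nat.exists_eq_add_of_le (le_trans (Nat.le_add_right K N) hk)
    exact hN m (by omega)

end Sturm
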